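/- arXiv:2007.00967 — 3 statements merged into one kernel-verified Lean document; each statement's English description precedes it below -/
import Mathlib

section
/- Fix a prime p. The following are equivalent: (i) for every finite group G with Sylow p-subgroup P, one has (∏_{x ∈ P} λ_G(x))^p ≤ n_p(G)^{|P|}; (ii) the same inequality (∏_{x ∈ A_p} λ_A(x))^p ≤ n_p(A)^{|A_p|} holds for every finite almost simple group A, where A_p is a Sylow p-subgroup of A. -/
open Subgroup

/-- `λ_G(x)`: the number of Sylow `p`-subgroups of `G` containing `x`. -/
noncomputable def sylCount (p : ℕ) {G : Type*} [Group G] (x : G) : ℕ :=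
  Nat.card {Q : Sylow p G // x ∈ Q}

/-- A finite group `A` is almost simple if it has a nonabelian simple normal subgroup
whose centralizer in `A` is trivial. -/
def IsAlmostSimple (A : Type*) [Group A] : Prop :=
  ∃ S : Subgroup A, S.Normal ∧ IsSimpleGroup S ∧ (¬ ∀ a b : S, a * b = b * a) ∧
    Subgroup.centralizer (S : Set A) = ⊥


set_option linter.style.haveILetI false
set_option linter.unusedSimpArgs false

/-- The multiplicative inequality for a single group. -/
def MulIneq (p : ℕ) (G : Type) [Group G] : Prop := ∀ P : Sylow p G,
  (∏ᶠ x ∈ ((P : Subgroup G) : Set G), sylCount p x) ^ p ≤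
          Nat.card (Sylow p G) ^ Nat.card (P : Subgroup G)

/-- The logarithmic form of the inequality. -/
def LogIneq (p : ℕ) (G : Type) [Group G] : Prop := ∀ P : Sylow p G,
  (p : ℝ) * ∑ᶠ x : (P : Subgroup G), Real.log (sylCount p (x : G)) ≤
    Nat.card (P : Subgroup G) * Real.log (Nat.card (Sylow p G))

lemma sylCount_pos {p : ℕ} {G : Type} [Group G] [Finite G] (P : Sylow p G) {x : G} (hx : x ∈ P) :
    0 < sylCount p x := by
  unfold sylCount
  have : Nonempty {Q : Sylow p G // x ∈ Q} := ⟨⟨P, hx⟩⟩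
  exact Nat.card_pos

lemma mulIneq_iff_logIneq (p : ℕ) (G : Type) [Group G] [Finite G] :
    MulIneq p G ↔ LogIneq p G := by
  unfold MulIneq LogIneq
  refine forall_congr' fun P => ?_
  have := Fintype.ofFinite (P : Subgroup G)
  have e : (∏ᶠ x ∈ ((P : Subgroup G) : Set G), sylCount p x) =
      ∏ x : (P : Subgroup G), sylCount p (x : G) := by
    rw [← finprod_eq_prod_of_fintype]
    exact (finprod_set_coe_eq_finprod_mem (f := fun x : G => sylCount p x) ((P : Subgroup G) : Set G)).symm
  rw [e, finsum_eq_sum_of_fintype]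
  have hpos : ∀ x : (P : Subgroup G), (0 : ℝ) < sylCount p (x : G) := fun x => by
    exact_mod_cast sylCount_pos P x.2
  have hn : (0 : ℝ) < Nat.card (Sylow p G) := by
    exact_mod_cast Nat.card_pos
  rw [← Real.log_prod (fun x _ => (hpos x).ne'), ← Real.log_pow, ← Real.log_pow,
    Real.log_le_log_iff (pow_pos (Finset.prod_pos fun x _ => hpos x) _) (pow_pos hn _)]
  norm_cast

/-- Entropy inequality (grouping). -/
lemma entropy_aux {α β : Type*} [DecidableEq β] (s : Finset α) (t : Finset β) (f : α → β)
    (hf : ∀ a ∈ s, f a ∈ t) :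
    (s.card : ℝ) * Real.log s.card ≤ s.card * Real.log t.card +
      ∑ a ∈ s, Real.log ((s.filter (fun b => f b = f a)).card) := by
  rcases s.eq_empty_or_nonempty with rfl | hs
  · simp
  have hs0 : (0 : ℝ) < s.card := by exact_mod_cast hs.card_pos
  obtain ⟨a0, ha0⟩ := hs
  have ht0 : (0 : ℝ) < t.card := by exact_mod_cast Finset.card_pos.mpr ⟨_, hf _ ha0⟩
  have hm : ∀ a ∈ s, (0 : ℝ) < (s.filter (fun b => f b = f a)).card := fun a ha => by
    exact_mod_cast Finset.card_pos.mpr ⟨a, by simp [ha]⟩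
  have key : ∀ a ∈ s, Real.log s.card - Real.log t.card -
      Real.log ((s.filter (fun b => f b = f a)).card) ≤
      (s.card / t.card) * (1 / ((s.filter (fun b => f b = f a)).card : ℝ)) - 1 := by
    intro a ha
    have h1 := hm a ha
    have h2 := Real.log_le_sub_one_of_pos
      (mul_pos (div_pos hs0 ht0) (one_div_pos.mpr h1))
    rwa [Real.log_mul (div_pos hs0 ht0).ne' (one_div_pos.mpr h1).ne', Real.log_div hs0.ne' ht0.ne',
      one_div, Real.log_inv, ← one_div, ← sub_eq_add_neg] at h2
  have hsum : ∑ a ∈ s, (1 / ((s.filter (fun b => f b = f a)).card : ℝ)) ≤ t.card := by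
    rw [← Finset.sum_fiberwise_of_maps_to hf]
    calc _ ≤ ∑ b ∈ t, (1 : ℝ) := by
          refine Finset.sum_le_sum fun b hb => ?_
          have : ∀ a ∈ s.filter (fun a => f a = b), (1 / ((s.filter (fun b => f b = f a)).card : ℝ)) =
              1 / ((s.filter (fun a => f a = b)).card : ℝ) := by
            intro a ha
            rw [(Finset.mem_filter.mp ha).2]
          rw [Finset.sum_congr rfl this, Finset.sum_const, nsmul_eq_mul, one_div]
          exact mul_inv_le_one
      _ = _ := by simp
  have := Finset.sum_le_sum key
  simp only [Finset.sum_sub_distrib, Finset.sum_const, nsmul_eq_mul, ← Finset.mul_sum, mul_one] at this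
  have h3 : (s.card / t.card : ℝ) * ∑ a ∈ s, (1 / ((s.filter (fun b => f b = f a)).card : ℝ)) ≤ s.card := by
    calc _ ≤ (s.card / t.card : ℝ) * t.card := by gcongr
      _ = _ := by field_simp
  linarith

lemma sylCount_smul {p : ℕ} {G : Type} [Group G] (g x : G) :
    sylCount p (g * x * g⁻¹) = sylCount p x := by
  unfold sylCount
  symm
  refine Nat.card_congr ((MulAction.toPerm g : Equiv.Perm (Sylow p G)).subtypeEquiv fun Q => ?_)
  rw [MulAction.toPerm_apply, ← SetLike.mem_coe (p := g • Q), Sylow.coe_smul, Set.mem_smul_set_iff_inv_smul_mem]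
  simp [MulAut.smul_def, ← map_inv, MulAut.conj_apply, mul_assoc]

lemma mem_sylow_smul {p : ℕ} {G : Type} [Group G] (g x : G) (Q : Sylow p G) :
    x ∈ g • Q ↔ g⁻¹ * x * g ∈ Q := by
  rw [← SetLike.mem_coe (p := g • Q), Sylow.coe_smul, Set.mem_smul_set_iff_inv_smul_mem]
  simp [MulAut.smul_def, ← map_inv, MulAut.conj_apply]

/-- If a p-group is inside a Sylow of same card ... the sum is independent of Sylow -/
lemma sum_indep {p : ℕ} [Fact p.Prime] {G : Type} [Group G] [Finite G] (P Q : Sylow p G) :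
    ∑ᶠ x : (P : Subgroup G), Real.log (sylCount p (x : G)) =
    ∑ᶠ x : (Q : Subgroup G), Real.log (sylCount p (x : G)) := by
  obtain ⟨g, rfl⟩ := MulAction.exists_smul_eq G P Q
  refine finsum_eq_of_bijective (Sylow.equivSMul P g) (Sylow.equivSMul P g).bijective ?_
  intro x
  rw [← sylCount_smul g (x : G)]
  rfl

lemma card_sylow_eq {p : ℕ} [Fact p.Prime] {G : Type} [Group G] [Finite G] (P Q : Sylow p G) :
    Nat.card (P : Subgroup G) = Nat.card (Q : Subgroup G) :=
  Nat.card_congr (P.equiv Q).toEquiv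

/-- A fibre-counting lemma for equivariant maps onto a transitive set. -/
lemma card_fiber_mul {G α β : Type*} [Group G] [Finite α] [Finite β] [MulAction G α] [MulAction G β]
    [MulAction.IsPretransitive G β] (f : α → β) (hf : ∀ (g : G) a, f (g • a) = g • f a) (b : β) :
    Nat.card {a // f a = b} * Nat.card β = Nat.card α := by
  have : ∀ c, Nat.card {a // f a = c} = Nat.card {a // f a = b} := by
    intro c
    obtain ⟨g, rfl⟩ := MulAction.exists_smul_eq G c b
    refine Nat.card_congr ((MulAction.toPerm g : Equiv.Perm α).subtypeEquiv fun a => ?_)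
    simp [hf]
  have iβ := Fintype.ofFinite β
  rw [← Nat.card_congr (Equiv.sigmaFiberEquiv f), Nat.card_sigma]
  simp only [this, Finset.sum_const, Finset.card_univ, smul_eq_mul, Nat.card_eq_fintype_card (α := β), mul_comm]

lemma card_sylow_subgroup_le {p : ℕ} [Fact p.Prime] {G : Type} [Group G] [Finite G] (K : Subgroup G)
    (P : Sylow p G) (hP : (P : Subgroup G) ≤ K) :
    Nat.card (Sylow p K) ≤ Nat.card {Q : Sylow p G // (Q : Subgroup G) ≤ K} := by
  have hc : ∀ R : Sylow p K, Nat.card (R : Subgroup K) = Nat.card (P : Subgroup G) := by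
    intro R
    rw [card_sylow_eq R (P.subtype hP), Sylow.coe_subtype]
    exact Nat.card_congr (Subgroup.subgroupOfEquivOfLe hP).toEquiv
  have hc' : ∀ R : Sylow p K, Nat.card ((R : Subgroup K).map K.subtype) = p ^ (Nat.card G).factorization p := by
    intro R
    rw [← P.card_eq_multiplicity, ← hc R]
    exact Nat.card_congr ((R : Subgroup K).equivMapOfInjective _ K.subtype_injective).toEquiv.symm
  refine Nat.card_le_card_of_injective (fun R : Sylow p K =>
    (⟨Sylow.ofCard ((R : Subgroup K).map K.subtype) (hc' R), by
      rw [Sylow.coe_ofCard]; exact Subgroup.map_subtype_le _⟩ :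
        {Q : Sylow p G // (Q : Subgroup G) ≤ K})) ?_
  intro R R' h
  have h2 := congrArg (fun Q : {Q : Sylow p G // (Q : Subgroup G) ≤ K} => ((Q : Sylow p G) : Subgroup G)) h
  simp only [Sylow.coe_ofCard] at h2
  exact Sylow.ext (Subgroup.map_injective K.subtype_injective h2)

lemma card_le_sylCount {p : ℕ} [Fact p.Prime] {G : Type} [Group G] [Finite G] (K : Subgroup G)
    (x : K) : Nat.card {Q : Sylow p G // (Q : Subgroup G) ≤ K ∧ (x : G) ∈ Q} ≤ sylCount p x := by
  unfold sylCount
  refine Nat.card_le_card_of_injective (fun Q => ⟨Q.1.subtype Q.2.1, ?_⟩) ?_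
  · rw [← SetLike.mem_coe, ← Sylow.coe_coe, Sylow.coe_subtype]
    exact Q.2.2
  · intro Q Q' h
    exact Subtype.ext (Sylow.subtype_injective (hP := Q.2.1) (hQ := Q'.2.1) (congrArg Subtype.val h))

/-- A surjective homomorphism with all fibres over a Sylow. -/
lemma finsum_quot {p : ℕ} [Fact p.Prime] {G H : Type} [Group G] [Finite G] [Group H] [Finite H]
    (π : G →* H) (hπ : Function.Surjective π) (Q : Sylow p G) (φ : H → ℝ) :
    (Nat.card ((Q.mapSurjective hπ : Sylow p H) : Subgroup H) : ℝ) *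
      ∑ᶠ x : (Q : Subgroup G), φ (π x) =
    Nat.card (Q : Subgroup G) * ∑ᶠ y : ((Q.mapSurjective hπ : Sylow p H) : Subgroup H), φ y := by
  have := Fintype.ofFinite (Q : Subgroup G)
  have := Fintype.ofFinite ((Q.mapSurjective hπ : Sylow p H) : Subgroup H)
  classical
  rw [finsum_eq_sum_of_fintype, finsum_eq_sum_of_fintype]
  have hmem : ∀ x : (Q : Subgroup G), π x ∈ ((Q.mapSurjective hπ : Sylow p H) : Subgroup H) := by
    intro x
    rw [Sylow.coe_mapSurjective]
    exact ⟨x, x.2, rfl⟩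
  let f : (Q : Subgroup G) →* ((Q.mapSurjective hπ : Sylow p H) : Subgroup H) :=
    (π.comp (Q : Subgroup G).subtype).codRestrict _ hmem
  have hf : Function.Surjective f := by
    rintro ⟨y, hy⟩
    rw [Sylow.coe_mapSurjective] at hy
    obtain ⟨x, hx, rfl⟩ := hy
    exact ⟨⟨x, hx⟩, rfl⟩
  have hfib : ∀ y, Nat.card {x // f x = y} = Nat.card f.ker := by
    intro y
    obtain ⟨x, rfl⟩ := hf y
    refine Nat.card_congr ((Equiv.mulLeft x⁻¹).subtypeEquiv fun a => ?_)
    rw [Equiv.coe_mulLeft, MonoidHom.mem_ker, map_mul, map_inv, inv_mul_eq_one, eq_comm]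
  have hcard : Nat.card (Q : Subgroup G) =
      Nat.card f.ker * Nat.card ((Q.mapSurjective hπ : Sylow p H) : Subgroup H) := by
    rw [← Nat.card_congr (Equiv.sigmaFiberEquiv f), Nat.card_sigma]
    simp only [hfib, Finset.sum_const, Finset.card_univ, smul_eq_mul, mul_comm, ← Nat.card_eq_fintype_card]
  have hsum : ∑ x : (Q : Subgroup G), φ (π x) =
      Nat.card f.ker * ∑ y : ((Q.mapSurjective hπ : Sylow p H) : Subgroup H), φ y := by
    rw [← Finset.sum_fiberwise (s := Finset.univ) (g := f), Finset.mul_sum]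
    refine Finset.sum_congr rfl fun y _ => ?_
    have : ∀ x ∈ Finset.univ.filter (fun x => f x = y), φ (π x) = φ y := by
      intro x hx
      rw [← (Finset.mem_filter.mp hx).2]
      rfl
    rw [Finset.sum_congr rfl this, Finset.sum_const, nsmul_eq_mul, ← hfib y,
      Nat.card_eq_fintype_card, Fintype.card_subtype]
  rw [hsum, hcard]
  push_cast
  ring

lemma sum_filter_mem_eq {p : ℕ} {G : Type} [Group G] [Fintype G] (Q : Sylow p G)
    [DecidablePred (fun x => x ∈ Q)] (f : G → ℝ) :
    ∑ x ∈ Finset.univ.filter (fun x => x ∈ Q), f x = ∑ᶠ x : (Q : Subgroup G), f x := by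
  have := Fintype.ofFinite (Q : Subgroup G)
  rw [finsum_eq_sum_of_fintype]
  exact Finset.sum_subtype _ (fun x => by rw [Finset.mem_filter]; exact and_iff_right (Finset.mem_univ x)) f

lemma mapSurjective_eq_iff {p : ℕ} [Fact p.Prime] {G : Type} [Group G] [Finite G]
    (N : Subgroup G) [N.Normal] (Q Q' : Sylow p G) :
    Q'.mapSurjective (QuotientGroup.mk'_surjective N) =
      Q.mapSurjective (QuotientGroup.mk'_surjective N) ↔ (Q' : Subgroup G) ≤ (Q : Subgroup G) ⊔ N := by
  have hc : ∀ R : Sylow p G, ((R : Subgroup G).map (QuotientGroup.mk' N)).comap (QuotientGroup.mk' N)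
      = (R : Subgroup G) ⊔ N := fun R => by
    rw [Subgroup.comap_map_eq, QuotientGroup.ker_mk']
  constructor
  · intro h
    have h2 := congrArg (fun R : Sylow p (G ⧸ N) => (R : Subgroup (G ⧸ N))) h
    simp only [Sylow.coe_mapSurjective] at h2
    rw [← hc Q, ← h2, hc Q']
    exact le_sup_left
  · intro h
    have h2 : (Q' : Subgroup G).map (QuotientGroup.mk' N) ≤ (Q : Subgroup G).map (QuotientGroup.mk' N) := by
      rw [Subgroup.map_le_iff_le_comap, hc]
      exact h
    apply Sylow.ext
    have := (Q'.mapSurjective (QuotientGroup.mk'_surjective N)).is_maximal'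
      (Q.mapSurjective (QuotientGroup.mk'_surjective N)).isPGroup' (by
        rw [Sylow.coe_mapSurjective, Sylow.coe_mapSurjective]; exact h2)
    exact this.symm

lemma mapSurjective_smul {p : ℕ} [Fact p.Prime] {G : Type} [Group G] [Finite G]
    (N : Subgroup G) [N.Normal] (g : G) (Q : Sylow p G) :
    (g • Q).mapSurjective (QuotientGroup.mk'_surjective N) =
      (QuotientGroup.mk' N g) • Q.mapSurjective (QuotientGroup.mk'_surjective N) := by
  apply Sylow.ext
  ext y
  constructor
  · intro h
    rw [Sylow.coe_mapSurjective] at h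
    obtain ⟨x, hx, rfl⟩ := h
    change QuotientGroup.mk' N x ∈ (QuotientGroup.mk' N g) • Q.mapSurjective _
    rw [mem_sylow_smul]
    have hx' : x ∈ g • Q := hx
    rw [mem_sylow_smul] at hx'
    rw [← map_inv, ← map_mul, ← map_mul]
    exact ⟨_, hx', rfl⟩
  · intro h
    have h : y ∈ (QuotientGroup.mk' N g) • Q.mapSurjective (QuotientGroup.mk'_surjective N) := h
    rw [mem_sylow_smul] at h
    obtain ⟨x, hx, hxy⟩ := h
    rw [Sylow.coe_mapSurjective]
    refine ⟨g * x * g⁻¹, ?_, ?_⟩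
    · change g * x * g⁻¹ ∈ g • Q
      rw [mem_sylow_smul]
      have : g⁻¹ * (g * x * g⁻¹) * g = x := by group
      rw [this]; exact hx
    · rw [map_mul, map_mul, hxy, map_inv]; group

lemma card_sup_mul_le {p : ℕ} [Fact p.Prime] {G : Type} [Group G] [Finite G]
    (N : Subgroup G) [N.Normal] (Q : Sylow p G) :
    Nat.card (Sylow p ((Q : Subgroup G) ⊔ N : Subgroup G)) * Nat.card (Sylow p (G ⧸ N)) ≤
      Nat.card (Sylow p G) := by
  letI : MulAction G (Sylow p (G ⧸ N)) := MulAction.compHom _ (QuotientGroup.mk' N)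
  have : MulAction.IsPretransitive G (Sylow p (G ⧸ N)) := ⟨fun a b => by
    obtain ⟨g, hg⟩ := MulAction.exists_smul_eq (G ⧸ N) a b
    obtain ⟨g, rfl⟩ := QuotientGroup.mk'_surjective N g
    exact ⟨g, hg⟩⟩
  rw [← card_fiber_mul (G := G) (fun Q' : Sylow p G => Q'.mapSurjective (QuotientGroup.mk'_surjective N))
    (fun g a => mapSurjective_smul N g a) (Q.mapSurjective (QuotientGroup.mk'_surjective N))]
  refine Nat.mul_le_mul_right _ ?_
  refine (card_sylow_subgroup_le _ Q le_sup_left).trans (le_of_eq ?_)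
  exact Nat.card_congr (Equiv.subtypeEquivRight fun Q' => (mapSurjective_eq_iff N Q Q').symm)

theorem logIneq_of_normal {p : ℕ} [Fact p.Prime] {G : Type} [Group G] [Finite G]
    (N : Subgroup G) [N.Normal] (hq : LogIneq p (G ⧸ N))
    (hK : ∀ Q : Sylow p G, LogIneq p ((Q : Subgroup G) ⊔ N : Subgroup G)) : LogIneq p G := by
  classical
  have := Fintype.ofFinite G
  have := Fintype.ofFinite (Sylow p G)
  have := Fintype.ofFinite (Sylow p (G ⧸ N))
  set F : Sylow p G → Sylow p (G ⧸ N) := fun Q => Q.mapSurjective (QuotientGroup.mk'_surjective N) with hF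
  let s : G → Finset (Sylow p G) := fun x => Finset.univ.filter (fun Q => x ∈ Q)
  let t : G → Finset (Sylow p (G ⧸ N)) :=
    fun x => Finset.univ.filter (fun Q => QuotientGroup.mk' N x ∈ Q)
  have hs : ∀ x, ((s x).card) = sylCount p x := fun x => by
    simp only [s, sylCount]; rw [Nat.card_eq_fintype_card, Fintype.card_subtype]
  have ht : ∀ x, ((t x).card) = sylCount p (QuotientGroup.mk' N x) := fun x => by
    simp only [t, sylCount]; rw [Nat.card_eq_fintype_card, Fintype.card_subtype]
  have hst : ∀ x, ∀ Q ∈ s x, F Q ∈ t x := by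
    intro x Q hQ
    simp only [s, t, Finset.mem_filter, Finset.mem_univ, true_and] at hQ ⊢
    change QuotientGroup.mk' N x ∈ ((F Q : Sylow p (G ⧸ N)) : Subgroup (G ⧸ N))
    rw [hF, Sylow.coe_mapSurjective]
    exact ⟨x, hQ, rfl⟩
  let μ : Sylow p G → G → ℝ := fun Q x => (((s x).filter (fun Q' => F Q' = F Q)).card : ℝ)
  have h1 : ∀ x, ∑ Q ∈ s x, Real.log (sylCount p x) ≤
      ∑ Q ∈ s x, (Real.log (sylCount p (QuotientGroup.mk' N x)) + Real.log (μ Q x)) := by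
    intro x
    have := entropy_aux (s x) (t x) F (hst x)
    rw [Finset.sum_add_distrib, Finset.sum_const, Finset.sum_const, nsmul_eq_mul, nsmul_eq_mul,
      ← ht, ← hs]
    exact this
  have h2 := Finset.sum_le_sum (fun x (_ : x ∈ (Finset.univ : Finset G)) => h1 x)
  have hswap : ∀ f : G → Sylow p G → ℝ, ∑ x : G, ∑ Q ∈ s x, f x Q =
      ∑ Q : Sylow p G, ∑ᶠ x : (Q : Subgroup G), f x Q := by
    intro f
    rw [Finset.sum_comm' (t' := Finset.univ) (s' := fun Q => Finset.univ.filter (fun x => x ∈ Q))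
      (by simp [s])]
    exact Finset.sum_congr rfl fun Q _ => sum_filter_mem_eq Q (fun x => f x Q)
  rw [hswap, hswap] at h2
  have hp0 : (0 : ℝ) < p := by exact_mod_cast (Fact.out : p.Prime).pos
  -- bound for each Q
  have h3 : ∀ Q : Sylow p G, (p : ℝ) * ∑ᶠ x : (Q : Subgroup G),
      (Real.log (sylCount p (QuotientGroup.mk' N (x : G))) + Real.log (μ Q x)) ≤
      Nat.card (Q : Subgroup G) * Real.log (Nat.card (Sylow p G)) := by
    intro Q
    rw [finsum_add_distrib (Set.toFinite _) (Set.toFinite _), mul_add]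
    have a1 : (p : ℝ) * ∑ᶠ x : (Q : Subgroup G),
      (Real.log (sylCount p (QuotientGroup.mk' N (x : G)))) ≤
        Nat.card (Q : Subgroup G) * Real.log (Nat.card (Sylow p (G ⧸ N))) := by
      have e := finsum_quot (QuotientGroup.mk' N) (QuotientGroup.mk'_surjective N) Q
        (fun y => Real.log (sylCount p y))
      have b := hq (F Q)
      have c0 : (0 : ℝ) < Nat.card ((F Q : Sylow p (G ⧸ N)) : Subgroup (G ⧸ N)) := by
        exact_mod_cast Nat.card_pos
      have d0 : (0 : ℝ) ≤ Nat.card (Q : Subgroup G) := Nat.cast_nonneg _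
      refine le_of_mul_le_mul_left ?_ c0
      have := mul_le_mul_of_nonneg_left b d0
      calc _ = (p : ℝ) * (Nat.card ((F Q : Sylow p (G ⧸ N)) : Subgroup (G ⧸ N)) * ∑ᶠ x : (Q : Subgroup G),
              (Real.log (sylCount p (QuotientGroup.mk' N (x : G))))) := by ring
        _ = _ := by rw [e]
        _ = (Nat.card (Q : Subgroup G) : ℝ) * (p * ∑ᶠ y : ((F Q : Sylow p (G ⧸ N)) : Subgroup (G ⧸ N)),
              (Real.log (sylCount p (y : G ⧸ N)))) := by ring
        _ ≤ _ := this
        _ = _ := by ring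
    have a2 : (p : ℝ) * ∑ᶠ x : (Q : Subgroup G), Real.log (μ Q x) ≤
        Nat.card (Q : Subgroup G) * Real.log (Nat.card (Sylow p ((Q : Subgroup G) ⊔ N : Subgroup G))) := by
      have hle : (Q : Subgroup G) ≤ (Q : Subgroup G) ⊔ N := le_sup_left
      have b := hK Q (Q.subtype hle)
      rw [Sylow.coe_subtype, Nat.card_congr (Subgroup.subgroupOfEquivOfLe hle).toEquiv] at b
      refine le_trans ?_ b
      refine mul_le_mul_of_nonneg_left ?_ hp0.le
      rw [finsum_eq_of_bijective (f := fun x : (Q : Subgroup G).subgroupOf ((Q : Subgroup G) ⊔ N) =>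
        Real.log (sylCount p (x : ((Q : Subgroup G) ⊔ N : Subgroup G)))) (g := fun x : (Q : Subgroup G) =>
        Real.log (sylCount p (⟨x, hle x.2⟩ : ((Q : Subgroup G) ⊔ N : Subgroup G))))
        (Subgroup.subgroupOfEquivOfLe hle) (Subgroup.subgroupOfEquivOfLe hle).bijective (fun x => rfl)]
      have := Fintype.ofFinite (Q : Subgroup G)
      rw [finsum_eq_sum_of_fintype, finsum_eq_sum_of_fintype]
      refine Finset.sum_le_sum ?_
      intro x _
      have hx : Q ∈ (s x).filter (fun Q' => F Q' = F Q) := by simp [s]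
      have hpos : (0 : ℝ) < μ Q x := Nat.cast_pos.mpr (Finset.card_pos.mpr ⟨Q, hx⟩)
      refine Real.log_le_log hpos ?_
      have := card_le_sylCount (p := p) ((Q : Subgroup G) ⊔ N) ⟨x, hle x.2⟩
      refine le_trans (le_of_eq ?_) (Nat.cast_le.mpr this)
      simp only [μ]
      rw [Nat.card_eq_fintype_card, Fintype.card_subtype]
      congr 2
      ext Q'
      simp only [s, Finset.mem_filter, Finset.mem_univ, true_and, hF, mapSurjective_eq_iff]
      exact and_comm
    have n1 : (0 : ℝ) < Nat.card (Sylow p (G ⧸ N)) := by exact_mod_cast Nat.card_pos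
    have n2 : (0 : ℝ) < Nat.card (Sylow p ((Q : Subgroup G) ⊔ N : Subgroup G)) := by
      exact_mod_cast Nat.card_pos
    have a3 : Real.log (Nat.card (Sylow p (G ⧸ N))) +
        Real.log (Nat.card (Sylow p ((Q : Subgroup G) ⊔ N : Subgroup G))) ≤
        Real.log (Nat.card (Sylow p G)) := by
      rw [add_comm, ← Real.log_mul n2.ne' n1.ne']
      exact Real.log_le_log (mul_pos n2 n1) (by exact_mod_cast card_sup_mul_le N Q)
    have d0 : (0 : ℝ) ≤ Nat.card (Q : Subgroup G) := Nat.cast_nonneg _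
    have := mul_le_mul_of_nonneg_left a3 d0
    rw [mul_add] at this
    linarith
  intro P
  have h4 := Finset.sum_le_sum (fun Q (_ : Q ∈ (Finset.univ : Finset (Sylow p G))) => h3 Q)
  rw [← Finset.mul_sum] at h4
  have h5 := (mul_le_mul_of_nonneg_left h2 hp0.le).trans h4
  rw [Finset.sum_congr rfl (fun Q _ => sum_indep Q P),
    Finset.sum_congr rfl (fun Q _ => congrArg (fun n : ℕ => (n : ℝ) * Real.log (Nat.card (Sylow p G)))
      (card_sylow_eq Q P)), Finset.sum_const, Finset.sum_const,
    nsmul_eq_mul, nsmul_eq_mul] at h5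
  have n0 : (0 : ℝ) < (Finset.univ : Finset (Sylow p G)).card := by
    exact_mod_cast Finset.card_pos.mpr ⟨P, Finset.mem_univ _⟩
  refine le_of_mul_le_mul_left ?_ n0
  linarith

lemma sylCount_le {p : ℕ} {G : Type} [Group G] [Finite G] (x : G) :
    sylCount p x ≤ Nat.card (Sylow p G) :=
  Nat.card_le_card_of_injective Subtype.val Subtype.val_injective

lemma logIneq_of_normal_sylow {p : ℕ} [Fact p.Prime] {G : Type} [Group G] [Finite G]
    (P : Sylow p G) (hP : (P : Subgroup G).Normal) : LogIneq p G := by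
  have hu := Sylow.unique_of_normal P hP
  have h1 : Nat.card (Sylow p G) = 1 := Nat.card_unique
  intro Q
  have : ∀ x : (Q : Subgroup G), Real.log (sylCount p (x : G)) = 0 := by
    intro x
    have a := sylCount_pos Q x.2
    have b := sylCount_le (p := p) (x : G)
    have : sylCount p (x : G) = 1 := by omega
    simp [this]
  simp [this, h1]

lemma logIneq_of_isPGroup {p : ℕ} [Fact p.Prime] {G : Type} [Group G] [Finite G]
    (h : IsPGroup p G) : LogIneq p G := by
  obtain ⟨P⟩ : Nonempty (Sylow p G) := inferInstance
  have : (⊤ : Subgroup G) = P := P.is_maximal' (h.to_subgroup ⊤) le_top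
  refine logIneq_of_normal_sylow P ?_
  rw [← this]
  infer_instance

lemma indep_aux {A : Type*} [CommGroup A] (f : ℕ → A →* A)
    (hc : ∀ i j a, f i (f j a) = f j (f i a)) (p : ℕ)
    (hd : ∀ i j, i < j → j < p → ∀ a, f i a = a → f j a = a → a = 1) :
    ∀ k ≤ p, ∀ v : ℕ → A, (∀ i < k, f i (v i) = v i) → ∏ i ∈ Finset.range k, v i = 1 →
      ∀ i < k, v i = 1 := by
  intro k
  induction k with
  | zero => intro _ _ _ _ i hi; omega
  | succ k ih =>
    intro hk v hv hprod
    have h1 : ∀ i < k, f k (v i) / v i = 1 := by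
      refine ih (by omega) (fun i => f k (v i) / v i) ?_ ?_
      · intro i hi
        rw [map_div, hc, hv i (by omega)]
      · rw [Finset.prod_div_distrib, ← map_prod]
        rw [Finset.prod_range_succ] at hprod
        have e : ∏ i ∈ Finset.range k, v i = (v k)⁻¹ := eq_inv_of_mul_eq_one_left hprod
        rw [e, map_inv, hv k (by omega), div_self']
    have h2 : ∀ i < k, v i = 1 := fun i hi =>
      hd i k hi (by omega) _ (hv i (by omega)) (div_eq_one.mp (h1 i hi))
    intro i hi
    rcases Nat.lt_succ_iff_lt_or_eq.mp hi with h | rfl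
    · exact h2 i h
    · rw [Finset.prod_range_succ, Finset.prod_eq_one (fun j hj => h2 j (Finset.mem_range.mp hj)),
        one_mul] at hprod
      exact hprod

lemma indep_card {A : Type*} [CommGroup A] [Finite A] (f : ℕ → A →* A)
    (hc : ∀ i j a, f i (f j a) = f j (f i a)) (p : ℕ)
    (hd : ∀ i j, i < j → j < p → ∀ a, f i a = a → f j a = a → a = 1) :
    ∏ i ∈ Finset.range p, Nat.card {a // f i a = a} ≤ Nat.card A := by
  rw [Finset.prod_range, ← Nat.card_pi]
  refine Nat.card_le_card_of_injective
    (fun v : (∀ i : Fin p, {a // f i a = a}) => ∏ i, (v i : A)) ?_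
  intro v w h
  let u : ℕ → A := fun i => if hi : i < p then (v ⟨i, hi⟩ : A) / w ⟨i, hi⟩ else 1
  have hu := indep_aux f hc p hd p le_rfl u (by
    intro i hi
    simp only [u, hi, dite_true, map_div]
    rw [(v ⟨i, hi⟩).2, (w ⟨i, hi⟩).2]) (by
    rw [Finset.prod_range]
    simp only [u, Fin.is_lt, dite_true, Finset.prod_div_distrib]
    rw [div_eq_one]; exact h)
  funext i
  have := hu i i.2
  simp only [u, Fin.is_lt, dite_true] at this
  exact Subtype.ext (div_eq_one.mp this)

lemma sup_eq_top_of_quot {p : ℕ} [Fact p.Prime] {G : Type} [Group G] [Finite G]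
    (N : Subgroup G) [N.Normal] (h : IsPGroup p (G ⧸ N)) (P : Sylow p G) :
    (P : Subgroup G) ⊔ N = ⊤ := by
  have h1 : (⊤ : Subgroup (G ⧸ N)) = (P.mapSurjective (QuotientGroup.mk'_surjective N) : Sylow p (G ⧸ N)) :=
    (P.mapSurjective (QuotientGroup.mk'_surjective N)).is_maximal' (h.to_subgroup ⊤) le_top
  rw [Sylow.coe_mapSurjective] at h1
  have h2 := congrArg (Subgroup.comap (QuotientGroup.mk' N)) h1
  rw [Subgroup.comap_map_eq, QuotientGroup.ker_mk', Subgroup.comap_top] at h2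
  exact h2.symm

lemma le_normalizer_of_conj {G : Type} [Group G] (A K : Subgroup G)
    (hA : ∀ a ∈ A, ∀ k ∈ K, a * k * a⁻¹ ∈ K) : A ≤ normalizer (K : Set G) := by
  intro a ha
  rw [Subgroup.mem_normalizer_iff]
  intro h
  refine ⟨hA a ha h, fun hk => ?_⟩
  have := hA a⁻¹ (A.inv_mem ha) _ hk
  have e : a⁻¹ * (a * h * a⁻¹) * a⁻¹⁻¹ = h := by group
  rwa [e] at this

lemma normal_of_conj {G : Type} [Group G] (A B K : Subgroup G) (hAB : A ⊔ B = ⊤)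
    (hA : ∀ a ∈ A, ∀ k ∈ K, a * k * a⁻¹ ∈ K) (hB : ∀ a ∈ B, ∀ k ∈ K, a * k * a⁻¹ ∈ K) :
    K.Normal := by
  rw [← Subgroup.normalizer_eq_top_iff, eq_top_iff, ← hAB]
  exact sup_le (le_normalizer_of_conj A K hA) (le_normalizer_of_conj B K hB)

theorem logIneq_abelian {p : ℕ} [Fact p.Prime] {G : Type} [Group G] [Finite G]
    (N : Subgroup G) [N.Normal] (hab : ∀ a ∈ N, ∀ b ∈ N, a * b = b * a)
    (hq : IsPGroup p (G ⧸ N)) (hx : ∀ x ∈ N, x ^ p = 1 → x = 1)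
    (hmin : ∀ K : Subgroup G, K.Normal → K ≤ N → K ≠ ⊥ → K = N)
    (hall : ∀ K : Subgroup G, ∀ _ : K.Normal, K ≠ ⊥ → IsPGroup p (G ⧸ K)) : LogIneq p G := by
  have hp : p.Prime := Fact.out
  intro P
  have htop := sup_eq_top_of_quot N hq P
  have hdisj : ∀ x ∈ P, x ∈ N → x = 1 := by
    intro x hxP hxN
    obtain ⟨k, hk⟩ : ∃ k, x ^ p ^ k = 1 := by
      obtain ⟨k, hk⟩ := (isPGroup_iff_pow_pow_eq_one.mp P.isPGroup') ⟨x, hxP⟩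
      exact ⟨k, congrArg Subtype.val hk⟩
    induction k with
    | zero => simpa using hk
    | succ k ih =>
      apply ih
      apply hx _ (N.pow_mem hxN _)
      rw [← pow_mul, ← pow_succ, hk]
  by_cases hPb : (P : Subgroup G) = ⊥
  · exact logIneq_of_normal_sylow P (by rw [hPb]; infer_instance) P
  -- central element of order p
  have hPnt : Nontrivial (P : Subgroup G) := (Subgroup.nontrivial_iff_ne_bot _).mpr hPb
  have hcnt := P.isPGroup'.center_nontrivial
  have hpd : p ∣ Nat.card (Subgroup.center (P : Subgroup G)) := by
    rcases (P.isPGroup'.to_subgroup (Subgroup.center (P : Subgroup G))).card_eq_or_dvd with h | h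
    · exact absurd h (Finite.one_lt_card).ne'
    · exact h
  obtain ⟨z0, hz0⟩ := exists_prime_orderOf_dvd_card' p hpd
  obtain ⟨z, hz, hzo, hzc⟩ : ∃ z : G, z ∈ P ∧ orderOf z = p ∧ ∀ a ∈ P, z * a = a * z := by
    refine ⟨((z0 : (P : Subgroup G)) : G), (z0 : (P : Subgroup G)).2, ?_, ?_⟩
    · rw [Subgroup.orderOf_coe, Subgroup.orderOf_coe]; exact hz0
    · intro a ha
      exact congrArg Subtype.val ((Subgroup.mem_center_iff.mp z0.2 ⟨a, ha⟩).symm)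
  have hz1 : z ≠ 1 := by
    rintro rfl
    rw [orderOf_one] at hzo
    exact hp.one_lt.ne hzo
  by_cases hCb : (P : Subgroup G) ⊓ Subgroup.centralizer (N : Set G) = ⊥
  swap
  · have hCn : ((P : Subgroup G) ⊓ Subgroup.centralizer (N : Set G)).Normal := by
      refine normal_of_conj _ _ _ htop ?_ ?_
      · intro a ha k hk
        exact ⟨(P : Subgroup G).mul_mem ((P : Subgroup G).mul_mem ha hk.1) ((P : Subgroup G).inv_mem ha),
          (inferInstance : (Subgroup.centralizer (N : Set G)).Normal).conj_mem k hk.2 a⟩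
      · intro a ha k hk
        have h2 := Subgroup.mem_centralizer_iff.mp hk.2 a ha
        rw [h2, mul_inv_cancel_right]
        exact hk
    have h1 := hall _ hCn hCb
    have h2 : IsPGroup p ((P : Subgroup G) ⊓ Subgroup.centralizer (N : Set G) : Subgroup G) :=
      P.isPGroup'.to_inf_left
    refine logIneq_of_isPGroup ?_ P
    have h3 := (h1.to_subgroup ⊤).comap_of_ker_isPGroup
      (QuotientGroup.mk' ((P : Subgroup G) ⊓ Subgroup.centralizer (N : Set G)))
      (by rw [QuotientGroup.ker_mk']; exact h2)
    rw [Subgroup.comap_top] at h3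
    exact h3.of_equiv Subgroup.topEquiv
  have hKz : ∀ v ∈ N, z * v = v * z → v = 1 := by
    let K : Subgroup G := N ⊓ Subgroup.centralizer {z}
    have hKn : K.Normal := by
      refine normal_of_conj _ _ _ htop ?_ ?_
      · intro a ha k hk
        refine ⟨(inferInstance : N.Normal).conj_mem k hk.1 a, ?_⟩
        have h2 := Subgroup.mem_centralizer_singleton_iff.mp hk.2
        refine Subgroup.mem_centralizer_singleton_iff.mpr ?_
        have e1 := hzc a ha
        have e2 := hzc a⁻¹ ((P : Subgroup G).inv_mem ha)
        calc a * k * a⁻¹ * z = a * k * (a⁻¹ * z) := by group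
          _ = a * (k * z) * a⁻¹ := by rw [← e2]; group
          _ = (a * z) * k * a⁻¹ := by rw [h2]; group
          _ = z * (a * k * a⁻¹) := by rw [← e1]; group
      · intro a ha k hk
        rw [hab a ha k hk.1, mul_inv_cancel_right]
        exact hk
    by_contra hcon
    push Not at hcon
    obtain ⟨v, hv, hvz, hv1⟩ := hcon
    have hKb : K ≠ ⊥ := by
      intro h
      have : v ∈ K := ⟨hv, Subgroup.mem_centralizer_singleton_iff.mpr hvz.symm⟩
      rw [h] at this
      exact hv1 (Subgroup.mem_bot.mp this)
    have hKN := hmin K hKn inf_le_left hKb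
    have : z ∈ (P : Subgroup G) ⊓ Subgroup.centralizer (N : Set G) := by
      refine ⟨hz, ?_⟩
      refine Subgroup.mem_centralizer_iff.mpr ?_
      intro h hh
      have hh : h ∈ K := by rw [hKN]; exact hh
      exact Subgroup.mem_centralizer_singleton_iff.mp hh.2
    rw [hCb] at this
    exact hz1 (Subgroup.mem_bot.mp this)
  have hKm : ∀ m, 0 < m → m < p → ∀ v ∈ N, z ^ m * v = v * z ^ m → v = 1 := by
    intro m hm0 hmp v hv h
    apply hKz v hv
    have hco : m.Coprime (orderOf z) := by
      rw [hzo]; exact (Nat.coprime_of_lt_prime hm0.ne' hmp hp).symm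
    obtain ⟨n, hn⟩ := exists_pow_eq_self_of_coprime hco
    have : Commute (z ^ m) v := h
    have := this.pow_left n
    rw [hn] at this
    exact this
  -- counting Sylow subgroups
  have hinj : Function.Injective (fun v : N => (v : G) • P) := by
    intro v w h
    have h1 : ((w : G)⁻¹ * v) • P = P := by
      rw [mul_smul, show (v : G) • P = (w : G) • P from h, inv_smul_smul]
    have hu : (w : G)⁻¹ * v ∈ N := N.mul_mem (N.inv_mem w.2) v.2
    set u := (w : G)⁻¹ * v with hudef
    have : u = 1 := by
      apply hKz u hu
      have hzu : u * z * u⁻¹ ∈ P := by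
        rw [← h1, mem_sylow_smul]
        have : u⁻¹ * (u * z * u⁻¹) * u = z := by group
        rw [this]; exact hz
      have h2 : u * z * u⁻¹ * z⁻¹ = 1 := by
        apply hdisj
        · exact (P : Subgroup G).mul_mem hzu ((P : Subgroup G).inv_mem hz)
        · have := (inferInstance : N.Normal).conj_mem _ (N.inv_mem hu) z
          have := N.mul_mem hu this
          simpa [mul_assoc] using this
      have h3 : u * z = z * u := by
        calc u * z = (u * z * u⁻¹ * z⁻¹) * (z * u) := by group
          _ = _ := by rw [h2, one_mul]
      exact h3.symm
    rw [hudef, inv_mul_eq_one] at this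
    exact Subtype.ext this.symm
  have hsurj : ∀ Q : Sylow p G, ∃ v : N, (v : G) • P = Q := by
    intro Q
    obtain ⟨g, rfl⟩ := MulAction.exists_smul_eq G P Q
    have hg : g ∈ N ⊔ (P : Subgroup G) := by rw [sup_comm, htop]; exact Subgroup.mem_top g
    rw [← SetLike.mem_coe, Subgroup.normal_mul] at hg
    obtain ⟨v, hv, a, ha, rfl⟩ := hg
    refine ⟨⟨v, hv⟩, ?_⟩
    simp only [mul_smul]
    congr 1
    exact (Sylow.smul_eq_iff_mem_normalizer.mpr (Subgroup.le_normalizer ha)).symm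
  have hn : Nat.card N ≤ Nat.card (Sylow p G) := Nat.card_le_card_of_injective _ hinj
  have hlam : ∀ x ∈ P, sylCount p x ≤ Nat.card {v : N // x * v * x⁻¹ = (v : G)} := by
    intro x hxP
    unfold sylCount
    choose c hc using hsurj
    refine Nat.card_le_card_of_injective (fun Q => ⟨c Q.1, ?_⟩) ?_
    · have h1 : x ∈ ((c Q.1 : N) : G) • P := by rw [hc]; exact Q.2
      rw [mem_sylow_smul] at h1
      set v : G := ((c Q.1 : N) : G) with hv
      have hvN : v ∈ N := (c Q.1).2
      have h2 : v⁻¹ * x * v * x⁻¹ = 1 := by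
        apply hdisj
        · exact (P : Subgroup G).mul_mem h1 ((P : Subgroup G).inv_mem hxP)
        · have := (inferInstance : N.Normal).conj_mem _ hvN x
          have := N.mul_mem (N.inv_mem hvN) this
          simpa [mul_assoc] using this
      calc x * v * x⁻¹ = v * (v⁻¹ * x * v * x⁻¹) := by group
        _ = v := by rw [h2, mul_one]
    · intro Q Q' h
      have h1 : c Q.1 = c Q'.1 := congrArg Subtype.val h
      apply Subtype.ext
      rw [← hc Q.1, ← hc Q'.1, h1]
  letI : CommGroup N := { (inferInstance : Group N) with
    mul_comm := fun a b => Subtype.ext (hab a a.2 b b.2) }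
  have hprod : ∀ x ∈ P, ∏ i ∈ Finset.range p, sylCount p (x * z ^ i) ≤ Nat.card N := by
    intro x hxP
    let f : ℕ → N →* N := fun i => (MulAut.conjNormal (x * z ^ i)).toMonoidHom
    have hf : ∀ i (a : N), ((f i a : N) : G) = (x * z ^ i) * a * (x * z ^ i)⁻¹ := by
      intro i a
      exact MulAut.conjNormal_apply _ _
    have hzx : Commute z x := hzc x hxP
    have := indep_card f (by
        intro i j a
        apply Subtype.ext
        rw [hf, hf, hf, hf]
        have e : (x * z ^ i) * (x * z ^ j) = (x * z ^ j) * (x * z ^ i) := by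
          rw [mul_assoc, ← mul_assoc (z ^ i), (hzx.pow_left i).eq, mul_assoc x (z ^ j),
            ← mul_assoc (z ^ j), (hzx.pow_left j).eq, mul_assoc x, mul_assoc x, ← pow_add, ← pow_add,
            add_comm]
        calc x * z ^ i * (x * z ^ j * a * (x * z ^ j)⁻¹) * (x * z ^ i)⁻¹
            = ((x * z ^ i) * (x * z ^ j)) * a * ((x * z ^ i) * (x * z ^ j))⁻¹ := by group
          _ = _ := by rw [e]; group) p (by
        intro i j hij hjp a hi hj
        have hi := congrArg Subtype.val hi
        have hj := congrArg Subtype.val hj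
        rw [hf] at hi hj
        apply Subtype.ext
        apply hKm (j - i) (by omega) (by omega) _ a.2
        have e : x * z ^ j = x * z ^ i * z ^ (j - i) := by
          rw [mul_assoc, ← pow_add]; congr 2; omega
        rw [e] at hj
        have h1 : x * z ^ i * (z ^ (j - i) * a * (z ^ (j - i))⁻¹) * (x * z ^ i)⁻¹ =
            x * z ^ i * a * (x * z ^ i)⁻¹ := by
          rw [hi]
          refine Eq.trans ?_ hj
          group
        have h2 := mul_left_cancel (mul_right_cancel h1)
        exact mul_inv_eq_iff_eq_mul.mp h2)
    refine le_trans (Finset.prod_le_prod' fun i _ => ?_) this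
    refine (hlam _ ((P : Subgroup G).mul_mem hxP ((P : Subgroup G).pow_mem hz i))).trans (le_of_eq ?_)
    refine Nat.card_congr (Equiv.subtypeEquivRight fun a => ?_)
    rw [← hf, Subtype.ext_iff]
  have := Fintype.ofFinite (P : Subgroup G)
  rw [finsum_eq_sum_of_fintype]
  have hshift : ∀ i, ∑ x : (P : Subgroup G), Real.log (sylCount p (x : G)) =
      ∑ x : (P : Subgroup G), Real.log (sylCount p ((x : G) * z ^ i)) := by
    intro i
    exact (Equiv.sum_comp (Equiv.mulRight ((⟨z, hz⟩ : (P : Subgroup G)) ^ i))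
      (fun x : (P : Subgroup G) => Real.log (sylCount p (x : G)))).symm
  calc (p : ℝ) * ∑ x : (P : Subgroup G), Real.log (sylCount p (x : G))
      = ∑ i ∈ Finset.range p, ∑ x : (P : Subgroup G), Real.log (sylCount p (x : G)) := by
        simp
    _ = ∑ i ∈ Finset.range p, ∑ x : (P : Subgroup G), Real.log (sylCount p ((x : G) * z ^ i)) :=
        Finset.sum_congr rfl fun i _ => hshift i
    _ = ∑ x : (P : Subgroup G), ∑ i ∈ Finset.range p, Real.log (sylCount p ((x : G) * z ^ i)) :=
        Finset.sum_comm
    _ ≤ ∑ x : (P : Subgroup G), Real.log (Nat.card (Sylow p G)) := by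
        refine Finset.sum_le_sum fun x _ => ?_
        have hpos : ∀ i ∈ Finset.range p, (0 : ℝ) < sylCount p ((x : G) * z ^ i) := fun i _ => by
          exact_mod_cast sylCount_pos P ((P : Subgroup G).mul_mem x.2 ((P : Subgroup G).pow_mem hz i))
        rw [← Real.log_prod (fun i hi => (hpos i hi).ne')]
        refine Real.log_le_log (Finset.prod_pos hpos) ?_
        exact_mod_cast (hprod x x.2).trans hn
    _ = _ := by
        rw [Finset.sum_const, nsmul_eq_mul, Finset.card_univ, ← Nat.card_eq_fintype_card]

open scoped Pointwise in
lemma conjNormal_smul_mem {p : ℕ} {G : Type} [Group G] {M : Subgroup G} [M.Normal] (g : G)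
    (R : Sylow p M) (m : M) :
    m ∈ (MulAut.conjNormal g : MulAut M) • R ↔ (MulAut.conjNormal g⁻¹ : MulAut M) m ∈ R := by
  rw [map_inv]
  change m ∈ (MulAut.conjNormal g : MulAut M) • (R : Subgroup M) ↔ _
  rw [Subgroup.mem_pointwise_smul_iff_inv_smul_mem]
  rfl

lemma exists_res {p : ℕ} [Fact p.Prime] {G : Type} [Group G] [Finite G] (M : Subgroup G) [M.Normal]
    (P : Sylow p G) : ∃ R : Sylow p M, ∀ m : M, m ∈ R ↔ (m : G) ∈ P := by
  obtain ⟨R0⟩ : Nonempty (Sylow p M) := inferInstance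
  obtain ⟨Q0, hQ0⟩ := Sylow.exists_comap_subtype_eq R0
  obtain ⟨g, rfl⟩ := MulAction.exists_smul_eq G Q0 P
  refine ⟨(MulAut.conjNormal g : MulAut M) • R0, fun m => ?_⟩
  rw [conjNormal_smul_mem, mem_sylow_smul]
  change _ ∈ (R0 : Subgroup M) ↔ _
  rw [← hQ0, Subgroup.mem_comap]
  simp only [Subgroup.subtype_apply, MulAut.conjNormal_apply, inv_inv]
  rfl

lemma sylCount_mul_card {p : ℕ} [Fact p.Prime] {G : Type} [Group G] [Finite G] (M : Subgroup G) [M.Normal]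
    (x : M) : sylCount p (x : G) * Nat.card (Sylow p M) = sylCount p x * Nat.card (Sylow p G) := by
  choose res hres using exists_res (p := p) M
  have htr : ∀ a b : Sylow p M, ∃ g : G, (MulAut.conjNormal g : MulAut M) • a = b := by
    intro a b
    obtain ⟨g, hg⟩ := MulAction.exists_smul_eq M a b
    refine ⟨g, ?_⟩
    rw [← hg]
    apply SetLike.ext
    intro m
    rw [conjNormal_smul_mem, mem_sylow_smul]
    have : (MulAut.conjNormal ((g : G)⁻¹) : MulAut M) m = g⁻¹ * m * g := by
      apply Subtype.ext
      simp [MulAut.conjNormal_apply]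
    rw [this]
  letI : MulAction G (Sylow p M) := MulAction.compHom _ (MulAut.conjNormal : G →* MulAut M)
  have hsm : ∀ (g : G) (R : Sylow p M), g • R = (MulAut.conjNormal g : MulAut M) • R := fun _ _ => rfl
  have : MulAction.IsPretransitive G (Sylow p M) := ⟨htr⟩
  have hf : ∀ (g : G) (a : Sylow p G), res (g • a) = g • res a := by
    intro g a
    rw [hsm]
    apply SetLike.ext
    intro m
    rw [conjNormal_smul_mem, hres, hres, mem_sylow_smul, MulAut.conjNormal_apply, inv_inv]
  have hfib := card_fiber_mul (G := G) res hf
  have := Fintype.ofFinite {R : Sylow p M // x ∈ R}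
  have e : sylCount p (x : G) = ∑ R : {R : Sylow p M // x ∈ R}, Nat.card {Q // res Q = R} := by
    rw [← Nat.card_sigma]
    unfold sylCount
    refine Nat.card_congr ⟨fun Q => ⟨⟨res Q.1, (hres _ _).mpr Q.2⟩, ⟨Q.1, rfl⟩⟩,
      fun s => ⟨s.2.1, (hres _ _).mp (by rw [s.2.2]; exact s.1.2)⟩, fun Q => rfl, ?_⟩
    rintro ⟨⟨R, hR⟩, ⟨Q, hQ⟩⟩
    have hQ' : res Q = R := hQ
    subst hQ'
    rfl
  rw [e, Finset.sum_mul, Finset.sum_congr rfl (fun R _ => hfib R.1), Finset.sum_const, smul_eq_mul,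
    Finset.card_univ, ← Nat.card_eq_fintype_card]
  rfl

lemma exists_pow_mem {p : ℕ} [Fact p.Prime] {G : Type} [Group G] [Finite G] (M : Subgroup G) [M.Normal]
    (hM : M.index = p) {x : G} (hx : x ∉ M) (c : G ⧸ M) :
    ∃ k : ℕ, ((x : G ⧸ M)) ^ k = c := by
  have h1 : (x : G ⧸ M) ≠ 1 := by rwa [Ne, QuotientGroup.eq_one_iff]
  exact (mem_powers_of_prime_card (hM : Nat.card (G ⧸ M) = p) h1 (g' := c))

lemma sylCount_le_fix {p : ℕ} [Fact p.Prime] {G : Type} [Group G] [Finite G] (M : Subgroup G) [M.Normal]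
    (hM : M.index = p) {x : G} (hx : x ∉ M) :
    sylCount p x ≤ Nat.card {R : Sylow p M // (MulAut.conjNormal x : MulAut M) • R = R} := by
  choose res hres using exists_res (p := p) M
  unfold sylCount
  refine Nat.card_le_card_of_injective (fun Q => ⟨res Q.1, ?_⟩) ?_
  · apply SetLike.ext
    intro m
    rw [conjNormal_smul_mem, hres, hres, MulAut.conjNormal_apply, inv_inv]
    have hxQ : x ∈ (Q.1 : Subgroup G) := Q.2
    constructor
    · intro h
      have := (Q.1 : Subgroup G).mul_mem ((Q.1 : Subgroup G).mul_mem hxQ h) ((Q.1 : Subgroup G).inv_mem hxQ)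
      have e : x * (x⁻¹ * (m : G) * x) * x⁻¹ = m := by group
      rw [e] at this
      exact this
    · intro h
      exact (Q.1 : Subgroup G).mul_mem ((Q.1 : Subgroup G).mul_mem ((Q.1 : Subgroup G).inv_mem hxQ) h) hxQ
  · have key : ∀ Q Q' : Sylow p G, x ∈ Q → x ∈ Q' → res Q = res Q' → ∀ y ∈ Q, y ∈ Q' := by
      intro Q Q' h h' e y hy
      obtain ⟨k, hk⟩ := exists_pow_mem M hM hx (y : G ⧸ M)
      rw [← QuotientGroup.mk_pow, QuotientGroup.eq] at hk
      have h1 : (⟨_, hk⟩ : M) ∈ res Q := (hres _ _).mpr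
        ((Q : Subgroup G).mul_mem ((Q : Subgroup G).inv_mem ((Q : Subgroup G).pow_mem h k)) hy)
      rw [e, hres] at h1
      have h2 := (Q' : Subgroup G).mul_mem ((Q' : Subgroup G).pow_mem h' k) h1
      rw [mul_inv_cancel_left] at h2
      exact h2
    intro Q Q' h
    have h := congrArg Subtype.val h
    apply Subtype.ext
    apply SetLike.ext
    exact fun y => ⟨key _ _ Q.2 Q'.2 h y, key _ _ Q'.2 Q.2 h.symm y⟩

theorem logIneq_index {p : ℕ} [Fact p.Prime] {G : Type} [Group G] [Finite G] (M : Subgroup G) [M.Normal]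
    (hM : M.index = p) (hlog : LogIneq p M)
    (hfix : ∀ x : G, x ∉ M →
      (Nat.card {R : Sylow p M // (MulAut.conjNormal x : MulAut M) • R = R}) ^ p ≤ Nat.card (Sylow p M)) :
    LogIneq p G := by
  classical
  have hp : p.Prime := Fact.out
  intro P
  obtain ⟨R, hR⟩ := exists_res M P
  have := Fintype.ofFinite (P : Subgroup G)
  have := Fintype.ofFinite (R : Subgroup M)
  have hRP := hlog R
  rw [finsum_eq_sum_of_fintype] at hRP ⊢
  let A : Finset (P : Subgroup G) := Finset.univ.filter (fun x => (x : G) ∈ M)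
  let e : (R : Subgroup M) ≃ {x : (P : Subgroup G) // (x : G) ∈ M} :=
    ⟨fun r => ⟨⟨(r : M), (hR _).mp r.2⟩, (r : M).2⟩, fun x => ⟨⟨x.1, x.2⟩, (hR _).mpr x.1.2⟩,
      fun _ => rfl, fun _ => rfl⟩
  have hAcard : A.card = Nat.card (R : Subgroup M) := by
    rw [Nat.card_congr e, Nat.card_eq_fintype_card, Fintype.card_subtype]
  have hAsum : ∀ f : G → ℝ, ∑ x ∈ A, f x = ∑ r : (R : Subgroup M), f ((r : M) : G) := by
    intro f
    rw [Finset.sum_subtype (p := fun x : (P : Subgroup G) => (x : G) ∈ M) A (by simp [A])]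
    exact (Equiv.sum_comp e (fun x => f ((x : (P : Subgroup G)) : G))).symm
  have hPR : Nat.card (P : Subgroup G) = p * Nat.card (R : Subgroup M) := by
    have h1 : M.relIndex (P : Subgroup G) ∣ p := by
      exact (Subgroup.relIndex_dvd_index_of_normal M (P : Subgroup G)).trans (dvd_of_eq hM)
    have h2 : M.relIndex (P : Subgroup G) ≠ 1 := by
      intro h
      rw [Subgroup.relIndex_eq_one] at h
      have := Subgroup.index_dvd_of_le h
      rw [hM] at this
      exact P.not_dvd_index this
    have h3 := (hp.eq_one_or_self_of_dvd _ h1).resolve_left h2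
    have h4 := Subgroup.index_mul_card (M.subgroupOf (P : Subgroup G))
    rw [← h4]
    congr 1
    exact Nat.card_congr e.symm
  set n : ℝ := ((Nat.card (Sylow p G) : ℕ) : ℝ) with hn
  set m : ℝ := ((Nat.card (Sylow p M) : ℕ) : ℝ) with hm
  set k : ℝ := ((Nat.card (R : Subgroup M) : ℕ) : ℝ) with hk
  have hn0 : 0 < n := by rw [hn]; exact_mod_cast Nat.card_pos
  have hm0 : 0 < m := by rw [hm]; exact_mod_cast Nat.card_pos
  have hp0 : (0 : ℝ) < p := by exact_mod_cast hp.pos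
  have hin : ∀ r : (R : Subgroup M), Real.log (sylCount p ((r : M) : G)) =
      Real.log (sylCount p (r : M)) + (Real.log n - Real.log m) := by
    intro r
    have h1 := sylCount_mul_card (p := p) M (r : M)
    have h1' : (sylCount p ((r : M) : G) : ℝ) * m = sylCount p (r : M) * n := by
      rw [hn, hm]; exact_mod_cast h1
    have a : (0 : ℝ) < sylCount p ((r : M) : G) := by
      exact_mod_cast sylCount_pos P ((hR _).mp r.2)
    have b : (0 : ℝ) < sylCount p (r : M) := by
      exact_mod_cast sylCount_pos R r.2
    have := congrArg Real.log h1'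
    rw [Real.log_mul a.ne' hm0.ne', Real.log_mul b.ne' hn0.ne'] at this
    linarith
  have hout : ∀ x ∈ Finset.univ.filter (fun x : (P : Subgroup G) => ¬ (x : G) ∈ M),
      (p : ℝ) * Real.log (sylCount p (x : G)) ≤ Real.log m := by
    intro x hx
    have hx : (x : G) ∉ M := (Finset.mem_filter.mp hx).2
    have h1 := (Nat.pow_le_pow_left (sylCount_le_fix M hM hx) p).trans (hfix x hx)
    have a : (0 : ℝ) < sylCount p (x : G) := by
      exact_mod_cast sylCount_pos P x.2
    rw [← Real.log_pow]
    exact Real.log_le_log (pow_pos a _) (by rw [hm]; exact_mod_cast h1)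
  have hBcard : ((Finset.univ.filter (fun x : (P : Subgroup G) => ¬ (x : G) ∈ M)).card : ℝ) =
      (p - 1) * k := by
    have := Finset.card_filter_add_card_filter_not (s := (Finset.univ : Finset (P : Subgroup G)))
      (fun x : (P : Subgroup G) => (x : G) ∈ M)
    rw [Finset.card_univ, ← Nat.card_eq_fintype_card, hPR, ← hAcard] at this
    have h2 : ((A.card : ℕ) : ℝ) + (Finset.univ.filter (fun x : (P : Subgroup G) => ¬ (x : G) ∈ M)).card =
        p * A.card := by exact_mod_cast this
    rw [hAcard] at h2
    linarith
  rw [← Finset.sum_filter_add_sum_filter_not Finset.univ (fun x : (P : Subgroup G) => (x : G) ∈ M),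
    mul_add, hAsum (fun x => Real.log (sylCount p x)), Finset.sum_congr rfl (fun r _ => hin r),
    Finset.sum_add_distrib, Finset.sum_const, nsmul_eq_mul, Finset.card_univ,
    ← Nat.card_eq_fintype_card, hPR]
  have hB := Finset.sum_le_sum hout
  rw [← Finset.mul_sum, Finset.sum_const, nsmul_eq_mul, hBcard] at hB
  push_cast
  rw [← hk]
  nlinarith [hRP, hB]

theorem fix_bound {p : ℕ} [Fact p.Prime] {G : Type} [Group G] [Finite G] (M : Subgroup G) [M.Normal]
    (hM : M.index = p) (N : Subgroup M) [N.Normal] (hN : IsPGroup p (M ⧸ N))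
    (L : G ⧸ M → Subgroup M) [hLn : ∀ c, (L c).Normal]
    (hconj : ∀ (x : G) c (m : M), m ∈ L c → (MulAut.conjNormal x : MulAut M) m ∈ L ((x : G ⧸ M) * c))
    (hbot : ∀ m : M, (∀ c, m ∈ L c) → m = 1)
    (hcrt : ∀ n : G ⧸ M → M, (∀ c, n c ∈ N) → ∃ m : M, ∀ c, (n c)⁻¹ * m ∈ L c)
    (x : G) (hx : x ∉ M) :
    (Nat.card {R : Sylow p M // (MulAut.conjNormal x : MulAut M) • R = R}) ^ p ≤ Nat.card (Sylow p M) := by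
  have := Fintype.ofFinite (G ⧸ M)
  let φ : ∀ c, Sylow p M → Sylow p (M ⧸ L c) := fun c R => R.mapSurjective (QuotientGroup.mk'_surjective (L c))
  have hφ : ∀ c R (y : M ⧸ L c), y ∈ φ c R ↔ ∃ r ∈ R, (r : M ⧸ L c) = y := by
    intro c R y
    change y ∈ ((φ c R : Sylow p (M ⧸ L c)) : Subgroup (M ⧸ L c)) ↔ _
    rw [Sylow.coe_mapSurjective]
    rfl
  have h1 : ∏ c, Nat.card (Sylow p (M ⧸ L c)) ≤ Nat.card (Sylow p M) := by
    rw [← Nat.card_pi]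
    refine Nat.card_le_card_of_surjective (fun R c => φ c R) ?_
    intro T
    obtain ⟨Q0⟩ : Nonempty (Sylow p M) := inferInstance
    have hex : ∀ c, ∃ n ∈ N, (QuotientGroup.mk' (L c) n) • φ c Q0 = T c := by
      intro c
      obtain ⟨g, hg⟩ := MulAction.exists_smul_eq (M ⧸ L c) (φ c Q0) (T c)
      obtain ⟨g, rfl⟩ := QuotientGroup.mk'_surjective _ g
      have hgt : g ∈ N ⊔ (Q0 : Subgroup M) := by
        rw [sup_comm, sup_eq_top_of_quot N hN Q0]; exact Subgroup.mem_top g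
      rw [← SetLike.mem_coe, Subgroup.normal_mul] at hgt
      obtain ⟨v, hv, a, ha, rfl⟩ := hgt
      refine ⟨v, hv, ?_⟩
      rw [← hg]
      simp only [φ]
      rw [← mapSurjective_smul, ← mapSurjective_smul, mul_smul,
        Sylow.smul_eq_iff_mem_normalizer.mpr (Subgroup.le_normalizer ha)]
    choose n hnN hn using hex
    obtain ⟨m, hm⟩ := hcrt n hnN
    refine ⟨m • Q0, ?_⟩
    funext c
    simp only [φ]
    rw [mapSurjective_smul, ← hn c]
    congr 1
    exact (QuotientGroup.eq.mpr (hm c)).symm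
  have h2 : ∀ c, Nat.card {R : Sylow p M // (MulAut.conjNormal x : MulAut M) • R = R} ≤
      Nat.card (Sylow p (M ⧸ L c)) := by
    intro c0
    refine Nat.card_le_card_of_injective (fun R => φ c0 R.1) ?_
    rintro ⟨R, hR⟩ ⟨R', hR'⟩ hRR
    have hRR : φ c0 R = φ c0 R' := hRR
    apply Subtype.ext
    change R = R'
    have hfx : ∀ S : Sylow p M, (MulAut.conjNormal x : MulAut M) • S = S → ∀ m,
        m ∈ S ↔ (MulAut.conjNormal x⁻¹ : MulAut M) m ∈ S := by
      intro S hS m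
      conv_lhs => rw [← hS]
      exact conjNormal_smul_mem x S m
    have hD : ∀ k : ℕ, ∀ a ∈ R', ∃ r ∈ R, r⁻¹ * a ∈ L (((x : G ⧸ M)) ^ k * c0) := by
      intro k
      induction k with
      | zero =>
        intro a ha
        have : (a : M ⧸ L c0) ∈ φ c0 R := by
          rw [hRR, hφ]; exact ⟨a, ha, rfl⟩
        obtain ⟨r, hr, e⟩ := (hφ _ _ _).mp this
        refine ⟨r, hr, ?_⟩
        rw [pow_zero, one_mul]
        exact QuotientGroup.eq.mp e
      | succ k ih =>
        intro a ha
        obtain ⟨r, hr, h⟩ := ih _ ((hfx R' hR' a).mp ha)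
        have h3 := hconj x _ _ h
        refine ⟨(MulAut.conjNormal x : MulAut M) r, ?_, ?_⟩
        · rw [hfx R hR]
          have : (MulAut.conjNormal x⁻¹ : MulAut M) ((MulAut.conjNormal x : MulAut M) r) = r := by
            rw [← MulAut.mul_apply, ← map_mul]; simp
          rw [this]; exact hr
        · rw [pow_succ', mul_assoc]
          have e : (MulAut.conjNormal x : MulAut M) (r⁻¹ * (MulAut.conjNormal x⁻¹ : MulAut M) a) =
              ((MulAut.conjNormal x : MulAut M) r)⁻¹ * a := by
            have e1 : (MulAut.conjNormal x : MulAut M) ((MulAut.conjNormal x⁻¹ : MulAut M) a) = a := by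
              rw [← MulAut.mul_apply, ← map_mul]; simp
            rw [map_mul, e1, map_inv]
          rw [e] at h3
          exact h3
    have hD' : ∀ c, ∀ a ∈ R', ∃ r ∈ R, r⁻¹ * a ∈ L c := by
      intro c
      obtain ⟨k, hk⟩ := exists_pow_mem M hM hx (c * c0⁻¹)
      have := hD k
      rwa [hk, inv_mul_cancel_right] at this
    let H : Subgroup M := ⨅ c, ((φ c R : Sylow p (M ⧸ L c)) : Subgroup (M ⧸ L c)).comap (QuotientGroup.mk' (L c))
    have hH : ∀ h, h ∈ H ↔ ∀ c, ∃ r ∈ R, (r : M ⧸ L c) = h := by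
      intro h
      simp only [H, Subgroup.mem_iInf, Subgroup.mem_comap]
      exact forall_congr' fun c => hφ c R _
    have hHp : IsPGroup p H := by
      obtain ⟨n, hn⟩ := IsPGroup.iff_card.mp R.isPGroup'
      rw [isPGroup_iff_pow_pow_eq_one]
      intro h
      refine ⟨n, ?_⟩
      apply Subtype.ext
      change (h : M) ^ p ^ n = 1
      apply hbot
      intro c
      obtain ⟨r, hr, e⟩ := (hH h).mp h.2 c
      rw [← QuotientGroup.eq_one_iff, QuotientGroup.mk_pow, ← e, ← QuotientGroup.mk_pow]
      have : (⟨r, hr⟩ : (R : Subgroup M)) ^ Nat.card (R : Subgroup M) = 1 := pow_card_eq_one'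
      have := congrArg Subtype.val this
      rw [hn] at this
      have this : r ^ p ^ n = 1 := this
      rw [this]; rfl
    have hRH : H = R := R.is_maximal' hHp (fun r hr => (hH r).mpr fun c => ⟨r, hr, rfl⟩)
    have hle : (R' : Subgroup M) ≤ R := by
      rw [← hRH]
      intro a ha
      rw [hH]
      intro c
      obtain ⟨r, hr, h⟩ := hD' c a ha
      exact ⟨r, hr, QuotientGroup.eq.mpr h⟩
    exact Sylow.ext (R'.is_maximal' R.isPGroup' hle)
  calc _ = ∏ c : G ⧸ M, Nat.card {R : Sylow p M // (MulAut.conjNormal x : MulAut M) • R = R} := by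
        rw [Finset.prod_const, Finset.card_univ, ← Nat.card_eq_fintype_card,
          show Nat.card (G ⧸ M) = p from hM]
    _ ≤ _ := Finset.prod_le_prod' fun c _ => h2 c
    _ ≤ _ := h1

lemma exists_normal_index {p : ℕ} [Fact p.Prime] {G : Type} [Group G] [Finite G] (N : Subgroup G) [N.Normal]
    (hN : IsPGroup p (G ⧸ N)) (U : Subgroup G) (hU : N ≤ U) (hne : U ≠ ⊤) :
    ∃ M : Subgroup G, M.Normal ∧ U ≤ M ∧ M.index = p := by
  have hp : p.Prime := Fact.out
  have hs := QuotientGroup.mk'_surjective N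
  have hUb : U.map (QuotientGroup.mk' N) ≠ ⊤ := by
    intro h
    apply hne
    have h1 := congrArg (Subgroup.comap (QuotientGroup.mk' N)) h
    rw [Subgroup.comap_map_eq, QuotientGroup.ker_mk', Subgroup.comap_top, sup_eq_left.mpr hU] at h1
    exact h1
  obtain ⟨K, hK, hUK⟩ := (eq_top_or_exists_le_coatom (U.map (QuotientGroup.mk' N))).resolve_left hUb
  have hnil := hN.isNilpotent
  have hKn : K.Normal := NormalizerCondition.normal_of_coatom K Group.normalizerCondition_of_isNilpotent hK
  have hKi : K.index = p := by
    obtain ⟨m, hm⟩ := IsPGroup.iff_card.mp hN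
    obtain ⟨n, hn⟩ := IsPGroup.iff_card.mp (hN.to_subgroup K)
    have hlt : n < m := by
      have h1 : Nat.card K < Nat.card (G ⧸ N) := by
        refine lt_of_le_of_ne (Subgroup.card_le_card_group K) ?_
        intro h
        exact hK.1 ((Subgroup.card_eq_iff_eq_top K).mp h)
      rw [hm, hn] at h1
      exact (Nat.pow_lt_pow_iff_right hp.one_lt).mp h1
    obtain ⟨K', hK', hle⟩ := Sylow.exists_subgroup_card_pow_succ
      (by rw [hm]; exact Nat.pow_dvd_pow p hlt) hn
    have hK't : K' = ⊤ := by
      apply hK.2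
      refine lt_of_le_of_ne hle ?_
      rintro rfl
      rw [hn] at hK'
      have := Nat.pow_right_injective hp.two_le hK'
      omega
    rw [hK't, Subgroup.card_top, ← Subgroup.index_mul_card K, hn, pow_succ'] at hK'
    exact Nat.eq_of_mul_eq_mul_right (pow_pos hp.pos n) hK'
  refine ⟨K.comap (QuotientGroup.mk' N), inferInstance, ?_, ?_⟩
  · exact Subgroup.map_le_iff_le_comap.mp hUK
  · rw [Subgroup.index_comap_of_surjective _ hs, hKi]

theorem logIneq_wreath {p : ℕ} [Fact p.Prime] {G : Type} [Group G] [Finite G]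
    (N : Subgroup G) [hNn : N.Normal] (hN : IsPGroup p (G ⧸ N))
    (hmin : ∀ K : Subgroup G, K.Normal → K ≤ N → K ≠ ⊥ → K = N)
    (hcent : Subgroup.centralizer (N : Set G) = ⊥)
    (S : Subgroup G) (hSN : S ≤ N) (hS : S ≠ ⊥) (hSn : ∀ n ∈ N, ∀ s ∈ S, n * s * n⁻¹ ∈ S)
    (hSmin : ∀ K : Subgroup G, K ≤ S → K ≠ ⊥ → (∀ n ∈ N, ∀ s ∈ K, n * s * n⁻¹ ∈ K) → K = S)
    (hnn : normalizer (S : Set G) ≠ ⊤)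
    (IH : ∀ M : Subgroup G, M ≠ ⊤ → LogIneq p M) : LogIneq p G := by
  classical
  have hp : p.Prime := Fact.out
  obtain ⟨M, hMn, hnM, hM⟩ := exists_normal_index N hN (normalizer (S : Set G))
    (le_normalizer_of_conj N S hSn) hnn
  have hNM : N ≤ M := (le_normalizer_of_conj N S hSn).trans hnM
  have hMt : M ≠ ⊤ := by
    rintro rfl
    rw [Subgroup.index_top] at hM
    exact hp.one_lt.ne hM
  let T : G → Subgroup G := fun g => S.comap (MulAut.conj g⁻¹).toMonoidHom
  have hT : ∀ g x, x ∈ T g ↔ g⁻¹ * x * g ∈ S := by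
    intro g x
    simp [T, Subgroup.mem_comap, MulAut.conj_apply]
  have hTconj : ∀ x g a, a ∈ T g → x * a * x⁻¹ ∈ T (x * g) := by
    intro x g a ha
    rw [hT] at ha ⊢
    have e : (x * g)⁻¹ * (x * a * x⁻¹) * (x * g) = g⁻¹ * a * g := by group
    rwa [e]
  have hTN : ∀ g, T g ≤ N := by
    intro g x hx
    have := hNn.conj_mem _ (hSN ((hT g x).mp hx)) g
    have e : g * (g⁻¹ * x * g) * g⁻¹ = x := by group
    rwa [e] at this
  have hTn : ∀ g, ∀ n ∈ N, ∀ s ∈ T g, n * s * n⁻¹ ∈ T g := by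
    intro g n hn s hs
    rw [hT] at hs ⊢
    have h1 : g⁻¹ * n * g ∈ N := by
      have := hNn.conj_mem _ hn g⁻¹
      rwa [inv_inv] at this
    have := hSn _ h1 _ hs
    have e : g⁻¹ * n * g * (g⁻¹ * s * g) * (g⁻¹ * n * g)⁻¹ = g⁻¹ * (n * s * n⁻¹) * g := by group
    rwa [e] at this
  have hTdisj : ∀ g h, (∃ x, x ≠ 1 ∧ x ∈ T g ∧ x ∈ T h) → T g ≤ T h := by
    rintro g h ⟨x, hx1, hxg, hxh⟩
    have hK := hSmin (S ⊓ (T h).comap (MulAut.conj g).toMonoidHom) inf_le_left ?_ ?_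
    · intro y hy
      have h1 := (hT g y).mp hy
      rw [← hK] at h1
      have h2 : g * (g⁻¹ * y * g) * g⁻¹ ∈ T h := h1.2
      have e : g * (g⁻¹ * y * g) * g⁻¹ = y := by group
      rwa [e] at h2
    · intro hb
      have h1 : g⁻¹ * x * g ∈ S ⊓ (T h).comap (MulAut.conj g).toMonoidHom := by
        refine ⟨(hT g x).mp hxg, ?_⟩
        change g * (g⁻¹ * x * g) * g⁻¹ ∈ T h
        have e : g * (g⁻¹ * x * g) * g⁻¹ = x := by group
        rwa [e]
      rw [hb, Subgroup.mem_bot] at h1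
      apply hx1
      have e : g * (g⁻¹ * x * g) * g⁻¹ = x := by group
      rw [← e, h1]; simp
    · rintro n hn s ⟨hs1, hs2⟩
      refine ⟨hSn n hn s hs1, ?_⟩
      replace hs2 : g * s * g⁻¹ ∈ T h := hs2
      change g * (n * s * n⁻¹) * g⁻¹ ∈ T h
      have := hTn h _ (hNn.conj_mem n hn g) _ hs2
      have e : g * n * g⁻¹ * (g * s * g⁻¹) * (g * n * g⁻¹)⁻¹ = g * (n * s * n⁻¹) * g⁻¹ := by group
      rwa [e] at this
  have hTne : ∀ g h : G, (g : G ⧸ M) ≠ h → T g ≠ T h := by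
    intro g h hgh e
    apply hgh
    rw [QuotientGroup.eq]
    apply hnM
    rw [Subgroup.mem_normalizer_iff]
    intro s
    have h1 : h * s * h⁻¹ ∈ T h ↔ s ∈ S := by
      rw [hT]
      have e : h⁻¹ * (h * s * h⁻¹) * h = s := by group
      rw [e]
    have h2 := hT g (h * s * h⁻¹)
    rw [e, h1] at h2
    rw [h2]
    have e : g⁻¹ * h * s * (g⁻¹ * h)⁻¹ = g⁻¹ * (h * s * h⁻¹) * g := by group
    rw [e]
  have hcomm : ∀ g h : G, (g : G ⧸ M) ≠ h → ∀ a ∈ T g, ∀ b ∈ T h, a * b = b * a := by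
    intro g h hgh a ha b hb
    by_contra hab
    have hx : a * b * a⁻¹ * b⁻¹ ≠ 1 := by
      intro h1
      apply hab
      rw [mul_inv_eq_one, mul_inv_eq_iff_eq_mul] at h1
      exact h1
    have hxh : a * b * a⁻¹ * b⁻¹ ∈ T h :=
      (T h).mul_mem (hTn h a (hTN g ha) b hb) ((T h).inv_mem hb)
    have hxg : a * b * a⁻¹ * b⁻¹ ∈ T g := by
      have := (T g).mul_mem ha (hTn g b (hTN h hb) a⁻¹ ((T g).inv_mem ha))
      rwa [← mul_assoc, ← mul_assoc] at this
    exact hTne g h hgh (le_antisymm (hTdisj g h ⟨_, hx, hxg, hxh⟩) (hTdisj h g ⟨_, hx, hxh, hxg⟩))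
  have hTN' : ⨆ g, T g = N := by
    apply hmin
    · refine ⟨fun a ha x => ?_⟩
      have : (⨆ g, T g) ≤ (⨆ g, T g).comap (MulAut.conj x).toMonoidHom := by
        refine iSup_le fun g a ha => ?_
        exact le_iSup T (x * g) (hTconj x g a ha)
      exact this ha
    · exact iSup_le hTN
    · intro hb
      apply hS
      rw [eq_bot_iff]
      intro s hs
      rw [← hb]
      exact le_iSup T 1 ((hT 1 s).mpr (by simpa using hs))
  let W : G ⧸ M → Subgroup G := fun c => ⨆ g : G, ⨆ (_ : (g : G ⧸ M) = c), T g
  let V : G ⧸ M → Subgroup G := fun c => ⨆ g : G, ⨆ (_ : (g : G ⧸ M) ≠ c), T g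
  have hTW : ∀ (g : G) c, (g : G ⧸ M) = c → T g ≤ W c := fun g c h =>
    le_iSup_of_le g (le_iSup_of_le h le_rfl)
  have hTV : ∀ (g : G) c, (g : G ⧸ M) ≠ c → T g ≤ V c := fun g c h =>
    le_iSup_of_le g (le_iSup_of_le h le_rfl)
  have hWV : ∀ c d, c ≠ d → W c ≤ V d := fun c d hcd =>
    iSup_le fun g => iSup_le fun hg => hTV g d (hg ▸ hcd)
  have hWN : ∀ c, W c ≤ N := fun c => iSup_le fun g => iSup_le fun _ => hTN g
  have hVconj : ∀ (x : G) c a, a ∈ V c → x * a * x⁻¹ ∈ V ((x : G ⧸ M) * c) := by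
    intro x c a ha
    have : V c ≤ (V ((x : G ⧸ M) * c)).comap (MulAut.conj x).toMonoidHom := by
      refine iSup_le fun g => iSup_le fun hg => fun a ha => ?_
      refine hTV (x * g) _ ?_ (hTconj x g a ha)
      rw [QuotientGroup.mk_mul]
      exact fun h => hg (mul_left_cancel h)
    exact this ha
  have hVT : ∀ (g : G) (v : G), v ∈ V (g : G ⧸ M) → ∀ a ∈ T g, v * a = a * v := by
    intro g v hv a ha
    have : V (g : G ⧸ M) ≤ Subgroup.centralizer {a} := by
      refine iSup_le fun h => iSup_le fun hh => fun b hb => ?_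
      rw [Subgroup.mem_centralizer_singleton_iff]
      exact hcomm h g hh b hb a ha
    exact Subgroup.mem_centralizer_singleton_iff.mp (this hv)
  have hVW : ∀ c, ∀ v ∈ V c, ∀ w ∈ W c, v * w = w * v := by
    intro c v hv w hw
    have : W c ≤ Subgroup.centralizer {v} := by
      refine iSup_le fun h => iSup_le fun hh => fun b hb => ?_
      rw [Subgroup.mem_centralizer_singleton_iff]
      subst hh
      exact (hVT h v hv b hb).symm
    exact (Subgroup.mem_centralizer_singleton_iff.mp (this hw)).symm
  have hdec : ∀ c, ∀ a ∈ N, ∃ w ∈ W c, ∃ v ∈ V c, a = w * v := by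
    intro c a ha
    rw [← hTN'] at ha
    induction ha using Subgroup.iSup_induction' with
    | hp g a ha =>
      by_cases hg : (g : G ⧸ M) = c
      · exact ⟨a, hTW g c hg ha, 1, one_mem _, (mul_one a).symm⟩
      · exact ⟨1, one_mem _, a, hTV g c hg ha, (one_mul a).symm⟩
    | h1 => exact ⟨1, one_mem _, 1, one_mem _, (one_mul _).symm⟩
    | hmul a b _ _ iha ihb =>
      obtain ⟨w, hw, v, hv, rfl⟩ := iha
      obtain ⟨w', hw', v', hv', rfl⟩ := ihb
      refine ⟨w * w', mul_mem hw hw', v * v', mul_mem hv hv', ?_⟩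
      rw [mul_assoc, ← mul_assoc v, hVW c v hv w' hw', mul_assoc w', ← mul_assoc w w']
  have hLn : ∀ c, ((V c).subgroupOf M).Normal := by
    intro c
    refine ⟨fun a ha x => ?_⟩
    rw [Subgroup.mem_subgroupOf] at ha ⊢
    have := hVconj x c a ha
    rwa [(QuotientGroup.eq_one_iff (x : G)).mpr x.2, one_mul] at this
  have hNN : (N.subgroupOf M).Normal := inferInstance
  have hpq : IsPGroup p (M ⧸ N.subgroupOf M) := by
    rw [isPGroup_iff_pow_pow_eq_one] at hN ⊢
    intro y
    obtain ⟨y, rfl⟩ := QuotientGroup.mk_surjective y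
    obtain ⟨k, hk⟩ := hN ((y : G) : G ⧸ N)
    refine ⟨k, ?_⟩
    rw [← QuotientGroup.mk_pow, QuotientGroup.eq_one_iff] at hk ⊢
    rw [Subgroup.mem_subgroupOf]
    exact_mod_cast hk
  refine logIneq_index M hM (IH M hMt) (fun x hx => ?_)
  refine fix_bound M hM (N.subgroupOf M) hpq (fun c => (V c).subgroupOf M) ?_ ?_ ?_ x hx
  · intro x c m hm
    rw [Subgroup.mem_subgroupOf] at hm ⊢
    rw [MulAut.conjNormal_apply]
    exact hVconj x c m hm
  · intro m hm
    have h1 : (m : G) ∈ Subgroup.centralizer (N : Set G) := by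
      have : N ≤ Subgroup.centralizer {(m : G)} := by
        rw [← hTN']
        refine iSup_le fun g => fun a ha => ?_
        rw [Subgroup.mem_centralizer_singleton_iff]
        exact (hVT g m (Subgroup.mem_subgroupOf.mp (hm g)) a ha).symm
      rw [Subgroup.mem_centralizer_iff]
      intro h hh
      exact Subgroup.mem_centralizer_singleton_iff.mp (this hh)
    rw [hcent, Subgroup.mem_bot] at h1
    exact Subtype.ext h1
  · intro n hn
    have := Fintype.ofFinite (G ⧸ M)
    have hmain : ∀ F : Finset (G ⧸ M), ∃ m ∈ N, (∀ c ∈ F, ((n c : M) : G)⁻¹ * m ∈ V c) ∧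
        ∀ c, c ∉ F → m ∈ V c := by
      intro F
      induction F using Finset.induction_on with
      | empty => exact ⟨1, one_mem _, by simp, fun _ _ => one_mem _⟩
      | insert c0 F hc0 ih =>
        obtain ⟨m, hm, h1, h2⟩ := ih
        obtain ⟨w, hw, v, hv, e⟩ := hdec c0 _ (Subgroup.mem_subgroupOf.mp (hn c0))
        refine ⟨m * w, mul_mem hm (hWN _ hw), ?_, ?_⟩
        · intro c hc
          rcases Finset.mem_insert.mp hc with rfl | hcF
          · rw [hVW _ m (h2 _ hc0) w hw, e]
            have e2 : (w * v)⁻¹ * (w * m) = v⁻¹ * m := by group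
            rw [e2]
            exact mul_mem (inv_mem hv) (h2 _ hc0)
          · rw [← mul_assoc]
            refine mul_mem (h1 c hcF) (hWV c0 c ?_ hw)
            rintro rfl
            exact hc0 hcF
        · intro c hc
          rw [Finset.mem_insert, not_or] at hc
          exact mul_mem (h2 c hc.2) (hWV c0 c (Ne.symm hc.1) hw)
    obtain ⟨m, hm, h1, -⟩ := hmain Finset.univ
    refine ⟨⟨m, hNM hm⟩, fun c => ?_⟩
    rw [Subgroup.mem_subgroupOf]
    exact h1 c (Finset.mem_univ c)

lemma exists_min_subgroup {G : Type} [Group G] [Finite G] (P : Subgroup G → Prop) (H : Subgroup G)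
    (hH : P H) : ∃ K, P K ∧ ∀ K', P K' → K' ≤ K → K' = K := by
  obtain ⟨K, hK, hmin⟩ := (wellFounded_lt (α := Subgroup G)).has_min {K | P K} ⟨H, hH⟩
  refine ⟨K, hK, fun K' hK' hle => ?_⟩
  by_contra hne
  exact hmin K' hK' (lt_of_le_of_ne hle hne)

theorem logIneq_step {p : ℕ} [Fact p.Prime] {G : Type} [Group G] [Finite G]
    (H : IsAlmostSimple G → LogIneq p G)
    (IHs : ∀ M : Subgroup G, M ≠ ⊤ → LogIneq p M)
    (IHq : ∀ N : Subgroup G, ∀ _ : N.Normal, N ≠ ⊥ → LogIneq p (G ⧸ N)) : LogIneq p G := by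
  have hp : p.Prime := Fact.out
  by_cases hall : ∀ K : Subgroup G, ∀ _ : K.Normal, K ≠ ⊥ → IsPGroup p (G ⧸ K)
  swap
  · push Not at hall
    obtain ⟨N, hN, hNb, hNp⟩ := hall
    refine logIneq_of_normal N (IHq N hN hNb) fun Q => IHs _ fun ht => hNp ?_
    have h1 : IsPGroup p ((Q : Subgroup G).map (QuotientGroup.mk' N)) := Q.isPGroup'.map _
    have h2 : (Q : Subgroup G).map (QuotientGroup.mk' N) = ⊤ := by
      have h3 := congrArg (Subgroup.map (QuotientGroup.mk' N)) ht
      rw [Subgroup.map_sup, QuotientGroup.map_mk'_self, sup_bot_eq,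
        Subgroup.map_top_of_surjective _ (QuotientGroup.mk'_surjective N)] at h3
      exact h3
    rw [h2] at h1
    exact h1.of_equiv Subgroup.topEquiv
  by_cases htriv : (⊤ : Subgroup G) = ⊥
  · apply logIneq_of_isPGroup
    have h1 : IsPGroup p (⊤ : Subgroup G) := by rw [htriv]; exact IsPGroup.of_bot
    exact h1.of_equiv Subgroup.topEquiv
  obtain ⟨N, ⟨hNn, hNb⟩, hmin'⟩ := exists_min_subgroup
    (fun K : Subgroup G => K.Normal ∧ K ≠ ⊥) ⊤ ⟨inferInstance, htriv⟩
  have hmin : ∀ K : Subgroup G, K.Normal → K ≤ N → K ≠ ⊥ → K = N := fun K h1 h2 h3 => hmin' K ⟨h1, h3⟩ h2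
  have hNq := hall N hNn hNb
  have ext : ∀ C D : Subgroup G, ∀ _ : C.Normal, ∀ _ : D.Normal, IsPGroup p (G ⧸ C) → IsPGroup p (G ⧸ D) →
      C ⊓ D = ⊥ → LogIneq p G := by
    intro C D hC hD h1 h2 h
    apply logIneq_of_isPGroup
    rw [isPGroup_iff_pow_pow_eq_one] at h1 h2 ⊢
    intro g
    obtain ⟨k, hk⟩ := h1 g
    obtain ⟨l, hl⟩ := h2 g
    refine ⟨k + l, ?_⟩
    rw [← QuotientGroup.mk_pow, QuotientGroup.eq_one_iff] at hk hl
    have : g ^ p ^ (k + l) ∈ C ⊓ D := by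
      constructor
      · rw [pow_add, pow_mul]; exact C.pow_mem hk _
      · rw [pow_add, mul_comm, pow_mul]; exact D.pow_mem hl _
    rwa [h, Subgroup.mem_bot] at this
  by_cases hab : ∀ a ∈ N, ∀ b ∈ N, a * b = b * a
  · by_cases hx : ∀ x ∈ N, x ^ p = 1 → x = 1
    · exact logIneq_abelian N hab hNq hx hmin hall
    · push Not at hx
      obtain ⟨x, hxN, hxp, hx1⟩ := hx
      let K : Subgroup G :=
        { carrier := {y | y ∈ N ∧ y ^ p = 1}
          mul_mem' := fun {a b} ha hb => ⟨mul_mem ha.1 hb.1, by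
            rw [Commute.mul_pow (hab a ha.1 b hb.1), ha.2, hb.2, one_mul]⟩
          one_mem' := ⟨one_mem _, one_pow _⟩
          inv_mem' := fun {a} ha => ⟨inv_mem ha.1, by rw [inv_pow, ha.2, inv_one]⟩ }
      have hK : K = N := by
        apply hmin
        · refine ⟨fun a ha g => ⟨hNn.conj_mem a ha.1 g, ?_⟩⟩
          rw [conj_pow, ha.2]; simp
        · exact fun y hy => hy.1
        · intro hb
          have : x ∈ K := ⟨hxN, hxp⟩
          rw [hb, Subgroup.mem_bot] at this
          exact hx1 this
      apply logIneq_of_isPGroup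
      rw [isPGroup_iff_pow_pow_eq_one] at hNq ⊢
      intro g
      obtain ⟨k, hk⟩ := hNq g
      refine ⟨k + 1, ?_⟩
      rw [← QuotientGroup.mk_pow, QuotientGroup.eq_one_iff, ← hK] at hk
      rw [pow_succ, pow_mul]
      exact hk.2
  have hCn : (Subgroup.centralizer (N : Set G)).Normal := Subgroup.normal_centralizer
  have hZ : Subgroup.centralizer (N : Set G) ⊓ N = ⊥ := by
    by_contra hb
    have := hmin _ (inferInstance : (Subgroup.centralizer (N : Set G) ⊓ N).Normal) inf_le_right hb
    apply hab
    intro a ha b hb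
    rw [← this] at hb
    exact Subgroup.mem_centralizer_iff.mp hb.1 a ha
  by_cases hcent : Subgroup.centralizer (N : Set G) = ⊥
  swap
  · exact ext _ _ hCn hNn (hall _ hCn hcent) hNq hZ
  obtain ⟨S, ⟨hSN, hSb, hSn⟩, hSmin'⟩ := exists_min_subgroup
    (fun K : Subgroup G => K ≤ N ∧ K ≠ ⊥ ∧ ∀ n ∈ N, ∀ s ∈ K, n * s * n⁻¹ ∈ K) N
    ⟨le_rfl, hNb, fun n hn s hs => mul_mem (mul_mem hn hs) (inv_mem hn)⟩
  by_cases hnn : normalizer (S : Set G) = ⊤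
  swap
  · exact logIneq_wreath N hNq hmin hcent S hSN hSb hSn
      (fun K h1 h2 h3 => hSmin' K ⟨h1.trans hSN, h2, h3⟩ h1) hnn IHs
  have hSnorm : S.Normal := Subgroup.normalizer_eq_top_iff.mp hnn
  have hSeq : S = N := hmin S hSnorm hSN hSb
  subst hSeq
  apply H
  refine ⟨S, hNn, ?_, ?_, hcent⟩
  · have : Nontrivial S := (Subgroup.nontrivial_iff_ne_bot S).mpr hNb
    refine ⟨fun K hK => ?_⟩
    by_cases hKb : K = ⊥
    · exact Or.inl hKb
    · right
      have h1 : K.map S.subtype = S := by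
        refine hSmin' _ ⟨Subgroup.map_subtype_le K, ?_, ?_⟩ (Subgroup.map_subtype_le K)
        · intro hb
          exact hKb ((Subgroup.map_eq_bot_iff_of_injective K S.subtype_injective).mp hb)
        · rintro n hn _ ⟨s, hs, rfl⟩
          exact ⟨_, hK.conj_mem s hs ⟨n, hn⟩, rfl⟩
      rw [eq_top_iff]
      intro y _
      have : (y : G) ∈ K.map S.subtype := by rw [h1]; exact y.2
      obtain ⟨z, hz, e⟩ := this
      have : z = y := Subtype.ext e
      rwa [← this]
  · intro h
    apply hab
    intro a ha b hb
    exact congrArg Subtype.val (h ⟨a, ha⟩ ⟨b, hb⟩)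

theorem logIneq_all {p : ℕ} [Fact p.Prime]
    (H : ∀ (A : Type) [Group A] [Finite A], IsAlmostSimple A → LogIneq p A) :
    ∀ n : ℕ, ∀ (G : Type) [Group G] [Finite G], Nat.card G = n → LogIneq p G := by
  intro n
  induction n using Nat.strong_induction_on with
  | _ n ih =>
    intro G _ _ hG
    refine logIneq_step (H G) (fun M hM => ih _ ?_ M rfl) (fun N _ hN => ih _ ?_ (G ⧸ N) rfl)
    · rw [← hG]
      refine lt_of_le_of_ne (Subgroup.card_le_card_group M) fun h => hM ?_
      exact (Subgroup.card_eq_iff_eq_top M).mp h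
    · rw [← hG, Subgroup.card_eq_card_quotient_mul_card_subgroup N]
      exact lt_mul_of_one_lt_right Nat.card_pos ((Subgroup.one_lt_card_iff_ne_bot N).mpr hN)

/-- Theorem 2 (reduction to almost simple groups): the inequality
`(∏_{x ∈ P} λ_G(x))^p ≤ n_p(G)^{|P|}` holds for every finite group if and only if
it holds for every finite almost simple group. -/
theorem lambda_ineq_iff_almost_simple (p : ℕ) (hp : p.Prime) :
    (∀ (G : Type) [Group G] [Fintype G] (P : Sylow p G),
        (∏ᶠ x ∈ ((P : Subgroup G) : Set G), sylCount p x) ^ p ≤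
          Nat.card (Sylow p G) ^ Nat.card (P : Subgroup G)) ↔
      (∀ (A : Type) [Group A] [Fintype A], IsAlmostSimple A →
        ∀ Q : Sylow p A,
          (∏ᶠ x ∈ ((Q : Subgroup A) : Set A), sylCount p x) ^ p ≤
            Nat.card (Sylow p A) ^ Nat.card (Q : Subgroup A)) := by
  have : Fact p.Prime := ⟨hp⟩
  constructor
  · intro h A _ _ _ Q
    exact h A Q
  · intro h G _ _
    refine (mulIneq_iff_logIneq p G).mpr (logIneq_all ?_ _ G rfl)
    intro A _ _ hA
    have := Fintype.ofFinite A
    exact (mulIneq_iff_logIneq p A).mp (h A hA)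
end

section
/- Let G be a finite group, p a prime, and P a Sylow p-subgroup of G. Then |𝔘_p(G)| = Σ_{x ∈ P} |G|/|S_G(x)|, where the sum is of rational numbers (each |S_G(x)| is nonzero since 1 ∈ S_G(x)). -/
open Subgroup

/-- `H` is subnormal in `K` (as subgroups of an ambient group `G`): there is a chain
`H = H₀ ⊴ H₁ ⊴ ⋯ ⊴ Hₙ = K` with each term normal in the next. -/
def IsSubnormalIn {G : Type*} [Group G] (H K : Subgroup G) : Prop :=
  ∃ (n : ℕ) (c : Fin (n + 1) → Subgroup G), c 0 = H ∧ c (Fin.last n) = K ∧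
    ∀ i : Fin n, c i.castSucc ≤ c i.succ ∧ ((c i.castSucc).subgroupOf (c i.succ)).Normal

/-- The subnormalizer `S_G(x)` of (the cyclic subgroup generated by) `x` in `G`:
the set of `g ∈ G` such that `⟨x⟩` is subnormal in `⟨x, g⟩`. -/
def subnormalizerSet {G : Type*} [Group G] (x : G) : Set G :=
  {g : G | IsSubnormalIn (zpowers x) (zpowers x ⊔ zpowers g)}

section Weights

open Classical in
lemma exists_weight {α : Type*} [PartialOrder α] [Finite α] (s : Finset α) :
    ∃ c : α → ℚ, ∀ M ∈ s, ∑ L ∈ s.filter (· ≤ M), c L = 1 := by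
  let c : α → ℚ := (wellFounded_lt (α := α)).fix
    (fun M ih => 1 - ∑ L ∈ (s.filter (· < M)).attach, ih L.1 (Finset.mem_filter.1 L.2).2)
  have hc : ∀ M, c M = 1 - ∑ L ∈ s.filter (· < M), c L := by
    intro M
    rw [← Finset.sum_attach (s.filter (· < M))]
    exact (wellFounded_lt (α := α)).fix_eq _ M
  refine ⟨c, fun M hM => ?_⟩
  have : s.filter (· ≤ M) = insert M (s.filter (· < M)) := by
    ext L
    simp only [Finset.mem_filter, Finset.mem_insert, le_iff_lt_or_eq]
    constructor
    · rintro ⟨h, h1 | h1⟩ <;> simp_all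
    · rintro (rfl | h) <;> simp_all
  rw [this, Finset.sum_insert (by simp), hc M]
  ring

open Classical in
lemma sum_weight_cone {α : Type*} [SemilatticeSup α] [Finite α] (s D : Finset α) (c : α → ℚ)
    (hc : ∀ M ∈ s, ∑ L ∈ s.filter (· ≤ M), c L = 1) (hD : D ⊆ s)
    (hdown : ∀ M ∈ D, ∀ L ∈ s, L ≤ M → L ∈ D) (T : α) (hT : T ∈ D)
    (hsup : ∀ L ∈ D, L ⊔ T ∈ D) : ∑ L ∈ D, c L = 1 := by
  let e : α → ℚ := fun M => ∑ L ∈ D.filter (fun L => L ⊔ T = M), c L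
  have h1 : ∀ M ∈ D, T ≤ M → ∑ M' ∈ D.filter (fun M' => T ≤ M' ∧ M' ≤ M), e M' = 1 := by
    intro M hM hTM
    rw [← hc M (hD hM)]
    have : s.filter (· ≤ M) = D.filter (· ≤ M) := by
      ext L
      simp only [Finset.mem_filter]
      exact ⟨fun h => ⟨hdown M hM L h.1 h.2, h.2⟩, fun h => ⟨hD h.1, h.2⟩⟩
    rw [this, ← Finset.sum_fiberwise_of_maps_to (s := D.filter (· ≤ M))
      (t := D.filter (fun M' => T ≤ M' ∧ M' ≤ M)) (g := fun L => L ⊔ T)]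
    · refine Finset.sum_congr rfl fun M' hM' => ?_
      simp only [Finset.mem_filter] at hM'
      refine Finset.sum_congr ?_ fun _ _ => rfl
      ext L
      simp only [Finset.mem_filter]
      constructor
      · rintro ⟨h, rfl⟩
        exact ⟨⟨h, le_sup_left.trans hM'.2.2⟩, rfl⟩
      · rintro ⟨⟨h, _⟩, rfl⟩
        exact ⟨h, rfl⟩
    · intro L hL
      simp only [Finset.mem_filter] at hL ⊢
      exact ⟨hsup L hL.1, le_sup_right, sup_le hL.2 hTM⟩
  have heT : e T = 1 := by
    rw [← h1 T hT le_rfl]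
    have : D.filter (fun M' => T ≤ M' ∧ M' ≤ T) = {T} := by
      ext L
      simp only [Finset.mem_filter, Finset.mem_singleton]
      exact ⟨fun h => le_antisymm h.2.2 h.2.1, by rintro rfl; exact ⟨hT, le_rfl, le_rfl⟩⟩
    rw [this, Finset.sum_singleton]
  have he0 : ∀ M, M ∈ D → T ≤ M → M ≠ T → e M = 0 := by
    intro M
    induction M using (wellFounded_lt (α := α)).induction with
    | _ M ih =>
      intro hM hTM hne
      have h := h1 M hM hTM
      have hsub : ({T, M} : Finset α) ⊆ D.filter (fun M' => T ≤ M' ∧ M' ≤ M) := by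
        intro L hL
        simp only [Finset.mem_insert, Finset.mem_singleton] at hL
        rcases hL with rfl | rfl <;> simp_all
      rw [← Finset.sum_subset hsub, Finset.sum_pair hne.symm, heT] at h
      · linarith
      · intro L hL hL'
        simp only [Finset.mem_filter, Finset.mem_insert, Finset.mem_singleton, not_or] at hL hL'
        exact ih L (lt_of_le_of_ne hL.2.2 hL'.2) hL.1 hL.2.1 hL'.1
  rw [← Finset.sum_fiberwise_of_maps_to (s := D) (t := D) (g := fun L => L ⊔ T) hsup]
  rw [← heT]
  refine Finset.sum_eq_single T ?_ (fun h => absurd hT h)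
  intro M hM hne
  by_cases hTM : T ≤ M
  · exact he0 M hM hTM hne
  · rw [Finset.filter_false_of_mem, Finset.sum_empty]
    rintro L _ rfl
    exact hTM le_sup_right

end Weights

section Casolo

variable {G : Type*} [Group G]

/-- relative (elementwise) subnormalizer of a `p`-subgroup -/
def relS (p : ℕ) (X H : Subgroup G) : Set G :=
  {g | g ∈ X ∧ ∃ K : Subgroup G, IsPGroup p K ∧ H ≤ K ∧ K ≤ X ∧ g ∈ normalizer (K : Set G)}

/-- Sylow subgroups of `X`, as subgroups of `G`, containing `H`. -/
def relSyl (p : ℕ) (X H : Subgroup G) : Set (Subgroup G) :=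
  {Q | Maximal (fun R : Subgroup G => IsPGroup p R ∧ R ≤ X) Q ∧ H ≤ Q}

lemma lt_inf_normalizer [Finite G] {p : ℕ} [Fact p.Prime] {H K : Subgroup G} (hK : IsPGroup p K)
    (h : H < K) : H < K ⊓ normalizer (H : Set G) := by
  have := hK.isNilpotent
  have h1 := Group.normalizerCondition_of_isNilpotent (G := K) (H.subgroupOf K)
    (lt_top_iff_ne_top.2 fun h' => not_le_of_gt h (subgroupOf_eq_top.1 h'))
  refine lt_of_le_of_ne (le_inf h.le le_normalizer) fun heq => ?_
  obtain ⟨x, hx, hx'⟩ := SetLike.exists_of_lt h1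
  apply hx'
  rw [mem_subgroupOf, heq]
  refine ⟨x.2, ?_⟩
  change (x : G) ∈ normalizer (H : Set G)
  rw [mem_normalizer_iff]
  intro y
  rw [mem_normalizer_iff] at hx
  constructor
  · intro hy
    simpa [mem_subgroupOf] using (hx ⟨y, h.le hy⟩).1 hy
  · intro hy
    have hyK : y ∈ K := by
      have := K.mul_mem (K.mul_mem (K.inv_mem x.2) (h.le hy)) x.2
      simpa [mul_assoc] using this
    simpa [mem_subgroupOf] using (hx ⟨y, hyK⟩).2 (by simpa [mem_subgroupOf] using hy)

/-- Sylow subgroups of the group `X` correspond to `relSyl p X ⊥`. -/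
noncomputable def relSylEquiv (p : ℕ) (X : Subgroup G) : Sylow p X ≃ relSyl p X ⊥ where
  toFun Q := ⟨(Q : Subgroup X).map X.subtype, ⟨⟨Q.isPGroup'.map _, map_subtype_le _⟩, by
    rintro R ⟨hR, hRX⟩ hle
    have h2 : R.subgroupOf X = Q := Q.is_maximal'
      (hR.of_equiv (subgroupOfEquivOfLe hRX).symm) (by
        intro y hy
        exact hle (mem_map_of_mem X.subtype hy))
    rw [← h2]
    change R ≤ (R.subgroupOf X).map X.subtype
    rw [subgroupOf_map_subtype]
    exact le_inf le_rfl hRX⟩, bot_le⟩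
  invFun R := 
    { toSubgroup := R.1.subgroupOf X
      isPGroup' := R.2.1.1.1.of_equiv (subgroupOfEquivOfLe R.2.1.1.2).symm
      is_maximal' := by
        intro Q hQ hle
        have h1 : R.1 ≤ Q.map X.subtype := by
          have := map_mono (f := X.subtype) hle
          rwa [subgroupOf_map_subtype, inf_eq_left.2 R.2.1.1.2] at this
        have h2 := R.2.1.2 ⟨hQ.map _, map_subtype_le _⟩ h1
        refine le_antisymm ?_ hle
        intro y hy
        exact h2 (mem_map_of_mem X.subtype hy) }
  left_inv Q := by
    apply Sylow.ext
    exact comap_map_eq_self_of_injective X.subtype_injective _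
  right_inv R := by
    apply Subtype.ext
    change (R.1.subgroupOf X).map X.subtype = R.1
    rw [subgroupOf_map_subtype, inf_eq_left.2 R.2.1.1.2]

lemma card_relSyl_mul [Finite G] {p : ℕ} [Fact p.Prime] {X H : Subgroup G}
    (hH : H ∈ relSyl p X ⊥) :
    Nat.card (relSyl p X ⊥) * Nat.card (X ⊓ normalizer (H : Set G) : Subgroup G) = Nat.card X := by
  rw [← Nat.card_congr (relSylEquiv p X)]
  rw [Sylow.card_eq_index_normalizer ((relSylEquiv p X).symm ⟨H, hH⟩)]
  have hn : (X ⊓ normalizer (H : Set G) : Subgroup G).subgroupOf X =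
      normalizer (((relSylEquiv p X).symm ⟨H, hH⟩ : Sylow p X) : Set X) := by
    have hc : (((relSylEquiv p X).symm ⟨H, hH⟩ : Sylow p X) : Set X) =
      ((H.subgroupOf X : Subgroup X) : Set X) := rfl
    rw [hc]
    ext x
    rw [mem_subgroupOf, mem_inf, mem_normalizer_iff, mem_normalizer_iff]
    simp only [mem_subgroupOf, Subtype.forall, coe_mul, coe_inv]
    constructor
    · exact fun h a ha => h.2 a
    · refine fun h => ⟨x.2, fun a => ?_⟩
      by_cases ha : a ∈ X
      · exact h a ha
      · refine ⟨fun h' => absurd (hH.1.1.2 h') ha, fun h' => absurd ?_ ha⟩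
        have := X.mul_mem (X.mul_mem (X.inv_mem x.2) (hH.1.1.2 h')) x.2
        simpa [mul_assoc] using this
  rw [← hn, ← Nat.card_congr (subgroupOfEquivOfLe (inf_le_left (a := X)
    (b := normalizer (H : Set G)))).toEquiv, mul_comm, card_mul_index]

lemma relSyl_bot_nonempty [Finite G] (p : ℕ) [Fact p.Prime] (X : Subgroup G) :
    0 < Nat.card (relSyl p X ⊥) := by
  rw [← Nat.card_congr (relSylEquiv p X)]
  exact Nat.card_pos

lemma relSyl_normal [Finite G] {p : ℕ} [Fact p.Prime] {X H : Subgroup G} (hp : IsPGroup p H)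
    (hHX : H ≤ X) (hn : X ≤ normalizer (H : Set G)) : relSyl p X H = relSyl p X ⊥ := by
  ext Q
  refine ⟨fun h => ⟨h.1, bot_le⟩, fun h => ⟨h.1, ?_⟩⟩
  exact le_sup_right.trans (h.1.2 ⟨h.1.1.1.to_sup_of_normal_right' hp (h.1.1.2.trans hn),
    sup_le h.1.1.2 hHX⟩ le_sup_left)

lemma relS_normal {p : ℕ} {X H : Subgroup G} (hp : IsPGroup p H)
    (hHX : H ≤ X) (hn : X ≤ normalizer (H : Set G)) : relS p X H = X := by
  ext g
  exact ⟨fun h => h.1, fun h => ⟨h, H, hp, le_rfl, hHX, hn h⟩⟩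

lemma relS_sylow {p : ℕ} {X H : Subgroup G} (hH : H ∈ relSyl p X ⊥) :
    relS p X H = (X ⊓ normalizer (H : Set G) : Subgroup G) := by
  ext g
  constructor
  · rintro ⟨hg, K, hK, hHK, hKX, hgK⟩
    have := le_antisymm hHK (hH.1.2 ⟨hK, hKX⟩ hHK)
    subst this
    exact ⟨hg, hgK⟩
  · rintro ⟨hg, hg'⟩
    exact ⟨hg, H, hH.1.1.1, le_rfl, hH.1.1.2, hg'⟩

lemma relSyl_sylow {p : ℕ} {X H : Subgroup G} (hH : H ∈ relSyl p X ⊥) :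
    relSyl p X H = {H} := by
  ext Q
  constructor
  · rintro ⟨h, hQ⟩
    exact le_antisymm (hH.1.2 h.1 hQ) hQ
  · rintro rfl
    exact ⟨hH.1, le_rfl⟩

lemma relS_inter {p : ℕ} {X N L : Subgroup G} (hNX : N ≤ X) (hLN : L ≤ N) :
    relS p N L = relS p X L ∩ N := by
  ext g
  constructor
  · rintro ⟨hg, K, hK, h1, h2, h3⟩
    exact ⟨⟨hNX hg, K, hK, h1, h2.trans hNX, h3⟩, hg⟩
  · rintro ⟨⟨_, K, hK, h1, h2, h3⟩, hg⟩
    exact ⟨hg, K ⊓ N, hK.to_inf_left, le_inf h1 hLN, inf_le_right,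
      inf_normalizer_le_normalizer_inf ⟨h3, le_normalizer hg⟩⟩

lemma exists_min_relS {p : ℕ} {X H : Subgroup G} {g : G} (hg : g ∈ relS p X H) :
    ∃ K : Subgroup G, IsPGroup p K ∧ H ≤ K ∧ K ≤ X ∧ g ∈ normalizer (K : Set G) ∧
      ∀ M : Subgroup G, IsPGroup p M → H ≤ M → M ≤ X → g ∈ normalizer (M : Set G) → K ≤ M := by
  obtain ⟨_, K0, hK0⟩ := hg
  let I := {K : Subgroup G // IsPGroup p K ∧ H ≤ K ∧ K ≤ X ∧ g ∈ normalizer (K : Set G)}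
  refine ⟨⨅ i : I, i.1, hK0.1.to_le (iInf_le (fun i : I => i.1) ⟨K0, hK0⟩),
    le_iInf fun i => i.2.2.1,
    (iInf_le (fun i : I => i.1) ⟨K0, hK0⟩).trans hK0.2.2.1,
    iInf_normalizer_le_normalizer_iInf _ (mem_iInf.2 fun i => i.2.2.2.2), ?_⟩
  intro M h1 h2 h3 h4
  exact iInf_le (fun i : I => i.1) ⟨M, h1, h2, h3, h4⟩

open Classical in
/-- The `p`-subgroups of `N_X(H)` properly containing `H`. -/
noncomputable def aboveN [Fintype (Subgroup G)] (p : ℕ) (N H : Subgroup G) : Finset (Subgroup G) :=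
  Finset.univ.filter fun L => IsPGroup p L ∧ H < L ∧ L ≤ N

open Classical in
lemma sum_syl [Finite G] [Fintype (Subgroup G)] {p : ℕ} [Fact p.Prime] {X Y N H : Subgroup G}
    (hN : N = X ⊓ normalizer (H : Set G)) (hYX : Y ≤ X) (hHY : H ∉ relSyl p Y ⊥)
    (c : Subgroup G → ℚ)
    (hc : ∀ M ∈ aboveN p N H, ∑ L ∈ (aboveN p N H).filter (· ≤ M), c L = 1) :
    ∑ L ∈ aboveN p N H, c L * (Nat.card (relSyl p Y L) : ℚ) = Nat.card (relSyl p Y H) := by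
  have h1 : ∀ L, (Nat.card (relSyl p Y L) : ℚ) =
      ∑ Q : Subgroup G, if Q ∈ relSyl p Y L then 1 else 0 := by
    intro L
    rw [Finset.sum_boole, Nat.card_eq_fintype_card, Fintype.card_subtype]
  simp_rw [h1, Finset.mul_sum]
  rw [Finset.sum_comm]
  refine Finset.sum_congr rfl fun Q _ => ?_
  split_ifs with hQ
  · have hne : H < Q := lt_of_le_of_ne hQ.2 (by rintro rfl; exact hHY ⟨hQ.1, bot_le⟩)
    have hM : Q ⊓ N ∈ aboveN p N H := by
      simp only [aboveN, Finset.mem_filter, Finset.mem_univ, true_and]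
      refine ⟨hQ.1.1.1.to_inf_left, ?_, inf_le_right⟩
      refine (lt_inf_normalizer hQ.1.1.1 hne).trans_le (le_inf inf_le_left ?_)
      rw [hN]
      exact inf_le_inf_right _ (hQ.1.1.2.trans hYX)
    have key := hc _ hM
    rw [Finset.sum_filter] at key
    refine Eq.trans ?_ key
    refine Finset.sum_congr rfl fun L hL => ?_
    simp only [aboveN, Finset.mem_filter, Finset.mem_univ, true_and] at hL
    have : Q ∈ relSyl p Y L ↔ L ≤ Q ⊓ N :=
      ⟨fun h => le_inf h.2 hL.2.2, fun h => ⟨hQ.1, h.trans inf_le_left⟩⟩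
    simp [this]
  · refine Finset.sum_eq_zero fun L hL => ?_
    simp only [aboveN, Finset.mem_filter, Finset.mem_univ, true_and] at hL
    rw [if_neg, mul_zero]
    exact fun h => hQ ⟨h.1, hL.2.1.le.trans h.2⟩

open Classical in
lemma sum_S [Finite G] [Fintype (Subgroup G)] {p : ℕ} [Fact p.Prime] {X N H : Subgroup G}
    (hN : N = X ⊓ normalizer (H : Set G)) (c : Subgroup G → ℚ)
    (hc : ∀ M ∈ aboveN p N H, ∑ L ∈ (aboveN p N H).filter (· ≤ M), c L = 1) :
    ∑ L ∈ aboveN p N H, c L * (Nat.card (relS p X L \ N : Set G) : ℚ)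
      = Nat.card (relS p X H \ N : Set G) := by
  have := Fintype.ofFinite G
  have h1 : ∀ L, (Nat.card (relS p X L \ N : Set G) : ℚ) =
      ∑ g : G, if g ∈ (relS p X L \ N : Set G) then 1 else 0 := by
    intro L
    rw [Finset.sum_boole, Nat.card_eq_fintype_card, Fintype.card_subtype]
  simp_rw [h1, Finset.mul_sum]
  rw [Finset.sum_comm]
  refine Finset.sum_congr rfl fun g _ => ?_
  split_ifs with hg
  · obtain ⟨hgS, hgN⟩ := hg
    obtain ⟨K, hK, hHK, hKX, hgK, hmin⟩ := exists_min_relS hgS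
    have hne : H < K := by
      refine lt_of_le_of_ne hHK ?_
      rintro rfl
      apply hgN
      rw [hN]
      exact ⟨hgS.1, hgK⟩
    have hT : H < K ⊓ N := by
      refine (lt_inf_normalizer hK hne).trans_le (le_inf inf_le_left ?_)
      rw [hN]
      exact inf_le_inf_right _ hKX
    have key := sum_weight_cone (aboveN p N H) ((aboveN p N H).filter (fun L => g ∈ relS p X L))
      c hc (Finset.filter_subset _ _) ?_ (K ⊓ N) ?_ ?_
    · rw [Finset.sum_filter] at key
      refine Eq.trans ?_ key
      refine Finset.sum_congr rfl fun L _ => ?_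
      have : g ∈ (relS p X L \ N : Set G) ↔ g ∈ relS p X L := ⟨fun h => h.1, fun h => ⟨h, hgN⟩⟩
      simp [this]
    · intro M hM L hL hLM
      rw [Finset.mem_filter] at hM ⊢
      obtain ⟨_, hgX, R, h1, h2, h3⟩ := hM
      exact ⟨hL, hgX, R, h1, hLM.trans h2, h3⟩
    · simp only [aboveN, Finset.mem_filter, Finset.mem_univ, true_and]
      exact ⟨⟨hK.to_inf_left, hT, inf_le_right⟩, hgS.1, K, hK, inf_le_left, hKX, hgK⟩
    · intro L hL
      simp only [aboveN, Finset.mem_filter, Finset.mem_univ, true_and] at hL ⊢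
      obtain ⟨⟨h1, h2, h3⟩, hgX, R, h4, h5, h6, h7⟩ := hL
      have hle : L ⊔ K ⊓ N ≤ R :=
        sup_le h5 (inf_le_left.trans (hmin R h4 (h2.le.trans h5) h6 h7))
      exact ⟨⟨h4.to_le hle, h2.trans_le le_sup_left, sup_le h3 inf_le_right⟩,
        hgX, R, h4, hle, h6, h7⟩
  · refine Finset.sum_eq_zero fun L hL => ?_
    simp only [aboveN, Finset.mem_filter, Finset.mem_univ, true_and] at hL
    rw [if_neg, mul_zero]
    rintro ⟨⟨hgX, R, h1, h2, h3⟩, h'⟩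
    exact hg ⟨⟨hgX, R, h1, hL.2.1.le.trans h2, h3⟩, h'⟩

lemma card_relS_split [Finite G] {p : ℕ} {X N L : Subgroup G} (hNX : N ≤ X) (hLN : L ≤ N) :
    (Nat.card (relS p X L) : ℚ) = Nat.card (relS p X L \ N : Set G) + Nat.card (relS p N L) := by
  rw [relS_inter hNX hLN]
  have := Set.ncard_inter_add_ncard_sdiff_eq_ncard (relS p X L) (N : Set G) (Set.toFinite _)
  simp only [Nat.card_coe_set_eq]
  rw [add_comm]
  exact_mod_cast this.symm

/-- Casolo's formula. -/
theorem casolo [Finite G] {p : ℕ} [Fact p.Prime] : ∀ (n : ℕ) (X H : Subgroup G),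
    Nat.card G - Nat.card H = n → IsPGroup p H → H ≤ X →
    (Nat.card (relS p X H) : ℚ) =
      Nat.card (relSyl p X H) * (Nat.card X / Nat.card (relSyl p X ⊥)) := by
  have := Fintype.ofFinite (Subgroup G)
  intro n
  induction n using Nat.strong_induction_on with
  | _ n ih =>
  intro X H hn hpH hHX
  have hs : (Nat.card (relSyl p X ⊥) : ℚ) ≠ 0 := by
    exact_mod_cast (relSyl_bot_nonempty p X).ne'
  by_cases hsyl : H ∈ relSyl p X ⊥
  · rw [relS_sylow hsyl, relSyl_sylow hsyl, ← card_relSyl_mul hsyl]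
    push_cast
    rw [mul_div_cancel_left₀ _ hs, Nat.card_unique (α := ({H} : Set (Subgroup G))), Nat.cast_one, one_mul]
    rfl
  set N : Subgroup G := X ⊓ normalizer (H : Set G) with hN
  have hNX : N ≤ X := inf_le_left
  have hHN : H ≤ N := le_inf hHX le_normalizer
  have hNn : N ≤ normalizer (H : Set G) := inf_le_right
  have hsN : (Nat.card (relSyl p N ⊥) : ℚ) ≠ 0 := by
    exact_mod_cast (relSyl_bot_nonempty p N).ne'
  have hsylN : H ∉ relSyl p N ⊥ := by
    intro h
    apply hsyl
    refine ⟨⟨⟨hpH, hHX⟩, ?_⟩, bot_le⟩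
    rintro R ⟨hR, hRX⟩ hHR
    by_contra hlt
    have h1 := lt_inf_normalizer hR (lt_of_le_not_ge hHR hlt)
    exact not_le_of_gt h1 (h.1.2 ⟨hR.to_inf_left, inf_le_inf_right _ hRX⟩ h1.le)
  obtain ⟨c, hc⟩ := exists_weight (aboveN p N H)
  rw [card_relS_split hNX hHN, ← sum_S hN c (by convert hc), relS_normal hpH hHN hNn]
  have e1 := sum_syl hN le_rfl hsyl c (by convert hc)
  have e2 := sum_syl hN hNX hsylN c (by convert hc)
  have e3 : ∀ L ∈ aboveN p N H, c L * (Nat.card (relS p X L \ N : Set G) : ℚ) =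
      c L * Nat.card (relSyl p X L) * (Nat.card X / Nat.card (relSyl p X ⊥)) -
      c L * Nat.card (relSyl p N L) * (Nat.card N / Nat.card (relSyl p N ⊥)) := by
    intro L hL
    simp only [aboveN, Finset.mem_filter, Finset.mem_univ, true_and] at hL
    have hcard : Nat.card G - Nat.card L < n := by
      have h1 : Nat.card H < Nat.card L := by
        exact Set.ncard_lt_ncard (s := (H : Set G)) (t := L) hL.2.1 (Set.toFinite _)
      have h2 : Nat.card L ≤ Nat.card G := card_le_card_group L
      omega
    have f1 := ih _ hcard X L rfl hL.1 (hL.2.2.trans hNX)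
    have f2 := ih _ hcard N L rfl hL.1 hL.2.2
    have f3 := card_relS_split (p := p) hNX hL.2.2
    have f4 : (Nat.card (relS p X L \ N : Set G) : ℚ) = 
      Nat.card (relSyl p X L) * (Nat.card X / Nat.card (relSyl p X ⊥)) -
       Nat.card (relSyl p N L) * (Nat.card N / Nat.card (relSyl p N ⊥)) := by
      rw [← f1, ← f2, f3]; ring
    rw [f4]; ring
  rw [Finset.sum_congr rfl e3, Finset.sum_sub_distrib, ← Finset.sum_mul, ← Finset.sum_mul, e1, e2,
    relSyl_normal hpH hHN hNn, mul_div_cancel₀ _ hsN]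
  simp

end Casolo

section Subnormal

variable {G : Type*} [Group G]

lemma IsSubnormalIn.cons {H H' K : Subgroup G} (hle : H ≤ H') (hn : H' ≤ normalizer (H : Set G))
    (h : IsSubnormalIn H' K) : IsSubnormalIn H K := by
  obtain ⟨n, c, h0, hl, hc⟩ := h
  refine ⟨n + 1, Fin.cons H c, rfl, ?_, ?_⟩
  · rw [← Fin.succ_last, Fin.cons_succ, hl]
  · intro i
    refine Fin.cases ?_ (fun i => ?_) i
    · change H ≤ c 0 ∧ (H.subgroupOf (c 0)).Normal
      rw [h0]
      exact ⟨hle, (normal_subgroupOf_iff_le_normalizer hle).2 hn⟩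
    · simp only [Fin.castSucc_succ, Fin.cons_succ]
      exact hc i

lemma IsSubnormalIn.refl (H : Subgroup G) : IsSubnormalIn H H :=
  ⟨0, fun _ => H, rfl, rfl, fun i => i.elim0⟩

lemma isSubnormalIn_of_pgroup [Finite G] {p : ℕ} [Fact p.Prime] (K A : Subgroup G)
    (hK : IsPGroup p K) (hKA : K ≤ A) (hA : A ≤ normalizer (K : Set G)) (H : Subgroup G) :
    H ≤ K → IsSubnormalIn H A := by
  induction H using (wellFounded_gt (α := Subgroup G)).induction with
  | _ H ih =>
  intro hHK
  rcases hHK.eq_or_lt with rfl | hlt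
  · exact (IsSubnormalIn.refl A).cons hKA hA
  · exact (ih _ (lt_inf_normalizer hK hlt) inf_le_left).cons (lt_inf_normalizer hK hlt).le
      inf_le_right

lemma exists_normal_of_chain_step [Finite G] {p : ℕ} [Fact p.Prime] {C C' K : Subgroup G}
    (hK : IsPGroup p K) (hKC : K ≤ C) (hCK : C ≤ normalizer (K : Set G)) (hCC : C ≤ C')
    (hn : C' ≤ normalizer (C : Set G)) :
    ∃ M : Subgroup G, IsPGroup p M ∧ K ≤ M ∧ M ≤ C' ∧ C' ≤ normalizer (M : Set G) := by
  obtain ⟨M, hKM, hM⟩ := (Set.toFinite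
    {R : Subgroup G | IsPGroup p R ∧ R ≤ C ∧ C ≤ normalizer (R : Set G)}).exists_le_maximal
    (a := K) ⟨hK, hKC, hCK⟩
  obtain ⟨⟨hM1, hM2, hM3⟩, hM4⟩ := hM
  have hgreat : ∀ R : Subgroup G, IsPGroup p R → R ≤ C → C ≤ normalizer (R : Set G) → R ≤ M := by
    intro R h1 h2 h3
    refine le_sup_right.trans (hM4 (y := M ⊔ R) ⟨hM1.to_sup_of_normal_right' h1 (hM2.trans h3),
      sup_le hM2 h2, ?_⟩ le_sup_left)
    intro g hg
    have a1 := mem_normalizer_iff_map_conj_eq.1 (hM3 hg)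
    have a2 := mem_normalizer_iff_map_conj_eq.1 (h3 hg)
    rw [mem_normalizer_iff_map_conj_eq, Subgroup.map_sup, a1, a2]
  refine ⟨M, hM1, hKM, hM2.trans hCC, ?_⟩
  rw [le_normalizer_iff]
  intro y hy m hm
  have hyC := mem_normalizer_iff_map_conj_eq.1 (hn hy)
  have hle : M.map (MulAut.conj y).toMonoidHom ≤ M := by
    refine hgreat _ (hM1.map _) ?_ ?_
    · refine (map_mono hM2).trans (le_of_eq hyC)
    · refine le_trans (le_of_eq hyC.symm) ?_
      refine le_trans (map_mono hM3) ?_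
      exact le_normalizer_map _
  exact hle (mem_map_of_mem (MulAut.conj y).toMonoidHom hm)

lemma subnormalizerSet_eq [Finite G] {p : ℕ} [Fact p.Prime] (x : G)
    (hx : IsPGroup p (zpowers x)) : subnormalizerSet x = relS p ⊤ (zpowers x) := by
  ext g
  constructor
  · rintro ⟨n, c, h0, hl, hc⟩
    have key : ∀ i : Fin (n + 1), ∃ K : Subgroup G, IsPGroup p K ∧ zpowers x ≤ K ∧ K ≤ c i ∧
        c i ≤ normalizer (K : Set G) := by
      intro i
      induction i using Fin.induction with
      | zero => exact ⟨zpowers x, hx, le_rfl, h0.ge, h0 ▸ le_normalizer⟩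
      | succ i ih =>
        obtain ⟨K, h1, h2, h3, h4⟩ := ih
        obtain ⟨M, m1, m2, m3, m4⟩ := exists_normal_of_chain_step h1 h3 h4 (hc i).1
          ((normal_subgroupOf_iff_le_normalizer (hc i).1).1 (hc i).2)
        exact ⟨M, m1, h2.trans m2, m3, m4⟩
    obtain ⟨K, h1, h2, h3, h4⟩ := key (Fin.last n)
    refine ⟨mem_top g, K, h1, h2, le_top, h4 ?_⟩
    rw [hl]
    exact mem_sup_right (mem_zpowers g)
  · rintro ⟨_, K, h1, h2, _, h4⟩
    have hA : zpowers x ⊔ zpowers g ≤ normalizer (K : Set G) :=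
      sup_le (h2.trans le_normalizer) (by rwa [zpowers_le])
    refine isSubnormalIn_of_pgroup (K ⊓ (zpowers x ⊔ zpowers g)) _ h1.to_inf_left inf_le_right ?_ _
      (le_inf h2 le_sup_left)
    exact le_trans (le_inf hA le_normalizer) inf_normalizer_le_normalizer_inf

/-- Sylow subgroups containing `H`. -/
def relSylTopEquiv (p : ℕ) (H : Subgroup G) : relSyl p ⊤ H ≃ {Q : Sylow p G // H ≤ Q} where
  toFun R := ⟨{ toSubgroup := R.1
                isPGroup' := R.2.1.1.1
                is_maximal' := fun hQ h => le_antisymm (R.2.1.2 ⟨hQ, le_top⟩ h) h }, R.2.2⟩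
  invFun Q := ⟨Q.1, ⟨⟨Q.1.isPGroup', le_top⟩, fun _ hR h => (Q.1.is_maximal' hR.1 h).le⟩, Q.2⟩
  left_inv _ := rfl
  right_inv _ := rfl

/-- number of Sylow subgroups containing `x` -/
noncomputable def lam (p : ℕ) (x : G) : ℕ := Nat.card {Q : Sylow p G // x ∈ Q}

lemma lam_conj (p : ℕ) (g x : G) : lam p (g * x * g⁻¹) = lam p x := by
  refine (Nat.card_congr ((MulAction.toPerm g).subtypeEquiv fun Q => ?_)).symm
  change x ∈ (Q : Subgroup G) ↔ g * x * g⁻¹ ∈ ((g • Q : Sylow p G) : Subgroup G)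
  rw [Sylow.coe_subgroup_smul, show g * x * g⁻¹ = MulAut.conj g • x from rfl,
    smul_mem_pointwise_smul_iff]

lemma quot_eq [Finite G] {p : ℕ} [Fact p.Prime] (x : G) (hx : IsPGroup p (zpowers x)) :
    (Nat.card G : ℚ) / (Nat.card (subnormalizerSet x) : ℚ) =
      Nat.card (Sylow p G) * (1 / lam p x) := by
  have h := casolo (p := p) _ ⊤ (zpowers x) rfl hx le_top
  rw [← subnormalizerSet_eq x hx, Nat.card_congr (relSylTopEquiv p (zpowers x)),
    ← Nat.card_congr (relSylEquiv p ⊤)] at h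
  have h1 : Nat.card {Q : Sylow p G // zpowers x ≤ Q} = lam p x :=
    Nat.card_congr (Equiv.subtypeEquivRight fun Q => by rw [zpowers_le]; rfl)
  have h2 : Nat.card (Sylow p (⊤ : Subgroup G)) = Nat.card (Sylow p G) := by
    rw [Nat.card_congr (relSylEquiv p ⊤), Nat.card_congr (relSylTopEquiv p ⊥)]
    exact Nat.card_congr (Equiv.subtypeUnivEquiv fun Q => bot_le)
  have h3 : Nat.card (⊤ : Subgroup G) = Nat.card G := card_top
  rw [h1, h2, h3] at h
  rw [h]
  have h4 : (Nat.card G : ℚ) ≠ 0 := by exact_mod_cast Nat.card_pos.ne'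
  have h5 : (Nat.card (Sylow p G) : ℚ) ≠ 0 := by exact_mod_cast Nat.card_pos.ne'
  obtain ⟨Q, hQ⟩ := hx.exists_le_sylow
  have : Nonempty {Q : Sylow p G // x ∈ Q} := ⟨Q, hQ (mem_zpowers x)⟩
  have h6 : (lam p x : ℚ) ≠ 0 := by
    have : 0 < lam p x := Nat.card_pos
    exact_mod_cast this.ne'
  field_simp

open Classical in
lemma sum_conj [Fintype G] {p : ℕ} [Fact p.Prime] (P Q : Sylow p G) :
    ∑ x : G, (if x ∈ Q then (1 / lam p x : ℚ) else 0) =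
      ∑ x : G, if x ∈ P then (1 / lam p x : ℚ) else 0 := by
  obtain ⟨g, rfl⟩ := MulAction.exists_smul_eq G P Q
  rw [← Equiv.sum_comp (MulAut.conj g).toEquiv]
  refine Finset.sum_congr rfl fun x _ => ?_
  have h : g * x * g⁻¹ ∈ g • P ↔ x ∈ P := by
    change g * x * g⁻¹ ∈ ((g • P : Sylow p G) : Subgroup G) ↔ x ∈ (P : Subgroup G)
    rw [Sylow.coe_subgroup_smul, show g * x * g⁻¹ = MulAut.conj g • x from rfl,
      smul_mem_pointwise_smul_iff]
  change (if g * x * g⁻¹ ∈ g • P then (1 / lam p (g * x * g⁻¹) : ℚ) else 0) = _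
  simp only [h, lam_conj]

lemma isPGroup_zpowers_iff {p : ℕ} [Fact p.Prime] [Finite G] (x : G) :
    IsPGroup p (zpowers x) ↔ ∃ n : ℕ, orderOf x = p ^ n := by
  rw [IsPGroup.iff_card, Nat.card_zpowers]

end Subnormal

/-- Lemma: `|𝔘_p(G)| = Σ_{x ∈ P} |G| / |S_G(x)|` (a sum of rational numbers). -/
theorem card_pElements_eq_sum_subnormalizer {G : Type*} [Group G] [Fintype G]
    (p : ℕ) (hp : p.Prime) (P : Sylow p G) :
    (Nat.card {g : G | ∃ n : ℕ, orderOf g = p ^ n} : ℚ) =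
      ∑ᶠ x ∈ ((P : Subgroup G) : Set G),
        (Nat.card G : ℚ) / (Nat.card (subnormalizerSet x) : ℚ) := by
  classical
  have : Fact p.Prime := ⟨hp⟩
  have := Fintype.ofFinite (Sylow p G)
  have hR : ∑ᶠ x ∈ ((P : Subgroup G) : Set G),
        (Nat.card G : ℚ) / (Nat.card (subnormalizerSet x) : ℚ) =
      Nat.card (Sylow p G) * ∑ x : G, if x ∈ P then (1 / lam p x : ℚ) else 0 := by
    rw [finsum_mem_def, finsum_eq_sum_of_fintype, Finset.mul_sum]
    refine Finset.sum_congr rfl fun x _ => ?_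
    rw [Set.indicator_apply]
    change (if x ∈ P then _ else _) = _
    split_ifs with hx
    · exact quot_eq x (P.isPGroup'.to_le (by rwa [zpowers_le]))
    · simp
  have hS : (Nat.card (Sylow p G) : ℚ) * ∑ x : G, (if x ∈ P then (1 / lam p x : ℚ) else 0) =
      ∑ Q : Sylow p G, ∑ x : G, if x ∈ Q then (1 / lam p x : ℚ) else 0 := by
    rw [Finset.sum_congr rfl fun Q _ => sum_conj P Q]
    simp
  rw [hR, hS, Finset.sum_comm]
  have hL : (Nat.card {g : G | ∃ n : ℕ, orderOf g = p ^ n} : ℚ) =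
      ∑ x : G, if (∃ n : ℕ, orderOf x = p ^ n) then (1 : ℚ) else 0 := by
    rw [Finset.sum_boole, Nat.card_eq_fintype_card, Fintype.card_subtype]
    rfl
  rw [hL]
  refine Finset.sum_congr rfl fun x _ => ?_
  rw [← Finset.sum_filter, Finset.sum_const, nsmul_eq_mul]
  have hlam : (Finset.univ.filter fun Q : Sylow p G => x ∈ Q).card = lam p x := by
    rw [lam, Nat.card_eq_fintype_card, Fintype.card_subtype]
  rw [hlam]
  split_ifs with hx
  · obtain ⟨Q, hQ⟩ := ((isPGroup_zpowers_iff (p := p) x).2 hx).exists_le_sylow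
    have : Nonempty {Q : Sylow p G // x ∈ Q} := ⟨Q, hQ (mem_zpowers x)⟩
    have h6 : (lam p x : ℚ) ≠ 0 := by
      have : 0 < lam p x := Nat.card_pos
      exact_mod_cast this.ne'
    field_simp
  · have : IsEmpty {Q : Sylow p G // x ∈ Q} := ⟨fun Q => hx
      ((isPGroup_zpowers_iff (p := p) x).1 (Q.1.isPGroup'.to_le (by rw [zpowers_le]; exact Q.2)))⟩
    simp [lam]
end

section
/- Let G be a finite group, p a prime, N a normal subgroup of G, P a Sylow p-subgroup of G, and x ∈ P. If G = NP, then |S_G(x)| = |S_N(x)| · |G/N| (note |G/N| = |NP/N| is a power of p). -/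
open Subgroup

/-- `S_N(x)` for a subgroup `N`: the set of `g ∈ N` with `⟨x⟩` subnormal in `⟨x, g⟩`. -/
def subnormalizerSetIn {G : Type*} [Group G] (N : Subgroup G) (x : G) : Set G :=
  {g : G | g ∈ N ∧ IsSubnormalIn (zpowers x) (zpowers x ⊔ zpowers g)}


namespace SubnAux
open scoped Classical in
theorem exists_mob {α : Type*} [PartialOrder α] (s : Finset α) :
    ∃ m : α → ℤ, ∀ a ∈ s, ∑ b ∈ s with a ≤ b, m b = 1 := by
  induction s using Finset.strongInduction with
  | H s ih =>
    rcases s.eq_empty_or_nonempty with rfl | hne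
    · exact ⟨0, by simp⟩
    · obtain ⟨a, ha⟩ := s.exists_minimal hne
      obtain ⟨m, hm⟩ := ih (s.erase a) (Finset.erase_ssubset ha.1)
      refine ⟨Function.update m a (1 - ∑ b ∈ s.erase a with a ≤ b, m b), ?_⟩
      intro c hc
      have key : ∀ c, ∑ b ∈ s.erase a with c ≤ b,
          Function.update m a (1 - ∑ b ∈ s.erase a with a ≤ b, m b) b
          = ∑ b ∈ s.erase a with c ≤ b, m b := by
        intro c
        apply Finset.sum_congr rfl
        intro b hb
        rw [Function.update_of_ne]
        simp at hb
        exact hb.1.1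
      by_cases hca : c = a
      · subst hca
        have : s.filter (fun b => c ≤ b) = insert c ((s.erase c).filter (fun b => c ≤ b)) := by
          ext b; simp; by_cases hb : b = c <;> simp [hb, hc]
        rw [this, Finset.sum_insert (by simp), key]
        simp
      · have hna : ¬ c ≤ a := fun h => hca (le_antisymm h (ha.2 hc h))
        have : s.filter (fun b => c ≤ b) = ((s.erase a).filter (fun b => c ≤ b)) := by
          ext b; simp; intro hcb hb; rintro rfl; exact hna hcb
        rw [this, key]
        exact hm c (by simp [hca, hc])

open scoped Classical in
theorem mob_unique {α : Type*} [PartialOrder α] (s : Finset α) (m m' : α → ℤ)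
    (h : ∀ a ∈ s, ∑ b ∈ s with a ≤ b, m b = ∑ b ∈ s with a ≤ b, m' b) :
    ∀ a ∈ s, m a = m' a := by
  by_contra! hcon
  obtain ⟨a0, ha0, hne⟩ := hcon
  obtain ⟨a, ha⟩ := (s.filter (fun a => m a ≠ m' a)).exists_maximal ⟨a0, by simp [ha0, hne]⟩
  have ha1 := ha.1
  simp only [Finset.mem_filter] at ha1
  have hs : s.filter (fun b => a ≤ b) = insert a (s.filter (fun b => a < b)) := by
    ext b; simp [le_iff_eq_or_lt]; grind
  have := h a ha1.1
  rw [hs, Finset.sum_insert (by simp), Finset.sum_insert (by simp)] at this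
  have h2 : ∑ b ∈ s with a < b, m b = ∑ b ∈ s with a < b, m' b := by
    apply Finset.sum_congr rfl
    intro b hb
    simp only [Finset.mem_filter] at hb
    by_contra hbne
    exact hb.2.not_ge (ha.2 (by simp [hb.1, hbne]) hb.2.le)
  apply ha1.2
  linarith

open scoped Classical in
/-- transfer of Moebius-type weights along a coclosure map. -/
theorem mob_transfer {α : Type*} [PartialOrder α] (s s' : Finset α) (hs : s' ⊆ s) (f : α → α)
    (hf : ∀ R ∈ s, f R ∈ s') (hadj : ∀ T ∈ s', ∀ R ∈ s, T ≤ f R ↔ T ≤ R) (m m' : α → ℤ)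
    (hm : ∀ a ∈ s, ∑ b ∈ s with a ≤ b, m b = 1)
    (hm' : ∀ a ∈ s', ∑ b ∈ s' with a ≤ b, m' b = 1)
    (Q : α) (hQ : Q ∈ s') (hfQ : ∀ R ∈ s, f R = Q ↔ R = Q) : m Q = m' Q := by
  have key := mob_unique s' (fun T => ∑ R ∈ s with f R = T, m R) m' ?_ Q hQ
  · rw [← key]
    have : s.filter (fun R => f R = Q) = {Q} := by
      ext R; simp only [Finset.mem_filter, Finset.mem_singleton]
      constructor
      · rintro ⟨h, h1⟩; exact (hfQ R h).1 h1
      · rintro rfl; exact ⟨hs hQ, (hfQ R (hs hQ)).2 rfl⟩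
    simp [this]
  · intro T hT
    rw [hm' T hT, ← hm T (hs hT)]
    rw [Finset.sum_comm' (s' := fun R => {f R}) (t' := s.filter (fun R => T ≤ R))]
    · simp
    · intro x y
      simp only [Finset.mem_filter, Finset.mem_singleton]
      constructor
      · rintro ⟨⟨h1, h2⟩, h3, rfl⟩
        exact ⟨rfl, h3, (hadj T hT _ h3).1 h2⟩
      · rintro ⟨rfl, h3, h2⟩
        exact ⟨⟨hf _ h3, (hadj T hT _ h3).2 h2⟩, h3, rfl⟩

theorem lt_inf_normalizer {G : Type*} [Group G] [Finite G] {p : ℕ} [Fact p.Prime]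
    {Q R : Subgroup G} (hR : IsPGroup p R) (h : Q < R) :
    Q < R ⊓ normalizer (Q : Set G) := by
  refine lt_of_le_of_ne (le_inf h.le le_normalizer) ?_
  intro he
  have : Group.IsNilpotent R := hR.isNilpotent
  have hc := normalizerCondition_iff_only_full_group_self_normalizing.1
    (Group.normalizerCondition_of_isNilpotent (G := R)) (Q.subgroupOf R) ?_
  · exact h.not_ge (subgroupOf_eq_top.1 hc)
  · rw [← subgroupOf_normalizer_eq h.le, ← inf_subgroupOf_left, ← he]

theorem sup_eq_top_of_sylow {K : Type*} [Group K] [Finite K] {p : ℕ} [Fact p.Prime]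
    (L : Subgroup K) {k : ℕ} (hL : L.index ∣ p ^ k) (P : Sylow p K) :
    L ⊔ (P : Subgroup K) = ⊤ := by
  rw [← index_eq_one]
  obtain ⟨j, -, hj⟩ := (Nat.dvd_prime_pow Fact.out).1
    ((index_dvd_of_le (le_sup_left : L ≤ L ⊔ (P : Subgroup K))).trans hL)
  rcases Nat.eq_zero_or_pos j with rfl | hpos
  · simpa using hj
  · exfalso
    apply P.not_dvd_index
    refine dvd_trans ?_ (index_dvd_of_le (le_sup_right : (P : Subgroup K) ≤ L ⊔ (P : Subgroup K)))
    rw [hj]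
    exact dvd_pow_self _ hpos.ne'

theorem sum_sylow {K : Type*} [Group K] [Finite K] {p : ℕ} [Fact p.Prime] [Fintype (Sylow p K)]
    (L : Subgroup K) [L.Normal] {k : ℕ} (hL : L.index ∣ p ^ k) :
    ∑ P : Sylow p K, Nat.card (L ⊓ normalizer ((P : Subgroup K) : Set K) : Subgroup K)
      = Nat.card L := by
  have htrans : ∀ P Q : Sylow p K, ∃ l ∈ L, l • P = Q := by
    intro P Q
    obtain ⟨a, ha⟩ := MulAction.exists_smul_eq K P Q
    have hm : a ∈ L ⊔ (P : Subgroup K) := by rw [sup_eq_top_of_sylow L hL P]; trivial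
    obtain ⟨l, hl, y, hy, rfl⟩ := Subgroup.mem_sup_of_normal_left.1 hm
    refine ⟨l, hl, ?_⟩
    rw [← ha, mul_smul]
    congr 1
    exact (Sylow.smul_eq_iff_mem_normalizer.2 (le_normalizer hy)).symm
  have hterm : ∀ P : Sylow p K, Fintype.card (Sylow p K) *
      Nat.card (L ⊓ normalizer ((P : Subgroup K) : Set K) : Subgroup K) = Nat.card L := by
    intro P
    have horb : MulAction.orbit L P = Set.univ := by
      ext Q; simp only [Set.mem_univ, iff_true]
      obtain ⟨l, hl, h⟩ := htrans P Q
      exact ⟨⟨l, hl⟩, h⟩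
    have h1 : (MulAction.stabilizer L P).index = Fintype.card (Sylow p K) := by
      rw [MulAction.index_stabilizer, horb, Set.ncard_univ, Nat.card_eq_fintype_card]
    have h2 : Nat.card (MulAction.stabilizer L P) =
        Nat.card (L ⊓ normalizer ((P : Subgroup K) : Set K) : Subgroup K) := by
      rw [← Subgroup.card_map_of_injective L.subtype_injective (K := MulAction.stabilizer L P)]
      congr! 3 with y
      simp only [Subgroup.mem_map, Subgroup.mem_inf]
      constructor
      · rintro ⟨⟨l, hl⟩, h, rfl⟩
        exact ⟨hl, Sylow.smul_eq_iff_mem_normalizer.1 h⟩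
      · rintro ⟨hl, h⟩
        exact ⟨⟨y, hl⟩, Sylow.smul_eq_iff_mem_normalizer.2 h, rfl⟩
    rw [← h1, ← h2, mul_comm, card_mul_index]
  have hpos : 0 < Fintype.card (Sylow p K) := Fintype.card_pos
  apply Nat.eq_of_mul_eq_mul_left hpos
  rw [Finset.mul_sum, Finset.sum_congr rfl (fun P _ => hterm P)]
  simp

open scoped Classical in
theorem exists_normal_pSubgroup {G : Type*} [Group G] [Finite G] {p : ℕ} {H K : Subgroup G}
    (hH : IsPGroup p H) (h : IsSubnormalIn H K) :
    ∃ R : Subgroup G, IsPGroup p R ∧ H ≤ R ∧ R ≤ K ∧ K ≤ normalizer (R : Set G) := by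
  obtain ⟨n, c, h0, hn, hc⟩ := h
  suffices ∀ i : Fin (n + 1), ∃ R : Subgroup G, IsPGroup p R ∧ H ≤ R ∧ R ≤ c i ∧
      c i ≤ normalizer (R : Set G) by
    simpa [hn] using this (Fin.last n)
  intro i
  induction i using Fin.induction with
  | zero => exact ⟨H, hH, le_rfl, h0.ge, h0 ▸ le_normalizer⟩
  | succ i ih =>
    obtain ⟨R0, hR0⟩ := ih
    obtain ⟨hle, hnorm⟩ := hc i
    have hnor := (normal_subgroupOf_iff_le_normalizer hle).1 hnorm
    obtain ⟨R, hR⟩ := (Set.toFinite {R : Subgroup G | IsPGroup p R ∧ H ≤ R ∧ R ≤ c i.castSucc ∧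
      c i.castSucc ≤ normalizer (R : Set G)}).exists_maximal ⟨R0, hR0⟩
    obtain ⟨⟨hRp, hHR, hRc, hcR⟩, hmax⟩ := hR
    refine ⟨R, hRp, hHR, hRc.trans hle, ?_⟩
    rw [le_normalizer_iff]
    intro y hy r hr
    have hynorm := hnor hy
    have hmapc := mem_normalizer_iff_map_conj_eq.1 hynorm
    set R' := R.map (MulAut.conj y).toMonoidHom with hR'
    have h1 : R' ≤ c i.castSucc := (Subgroup.map_mono hRc).trans hmapc.le
    have h2 : c i.castSucc ≤ normalizer (R' : Set G) := by
      refine le_trans hmapc.ge (le_trans (Subgroup.map_mono hcR) ?_)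
      exact le_normalizer_map _
    have h3 : IsPGroup p R' := hRp.map _
    have h4 : IsPGroup p (R ⊔ R' : Subgroup G) :=
      hRp.to_sup_of_normal_right' h3 (hRc.trans h2)
    have h5 : R ⊔ R' ≤ R := hmax ⟨h4, hHR.trans le_sup_left, sup_le hRc h1, by
      rw [le_normalizer_iff]
      intro a ha b hb
      have e1 := mem_normalizer_iff_map_conj_eq.1 (hcR ha)
      have e2 := mem_normalizer_iff_map_conj_eq.1 (h2 ha)
      have : (R ⊔ R').map (MulAut.conj a).toMonoidHom = R ⊔ R' := by
        rw [Subgroup.map_sup]; exact congrArg₂ _ e1 e2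
      rw [← this]
      exact ⟨b, hb, rfl⟩⟩ le_sup_left
    exact h5 (le_sup_right (a := R) ⟨r, hr, rfl⟩)

theorem IsSubnormalIn_cons {G : Type*} [Group G] {H H' K : Subgroup G} (hle : H ≤ H')
    (hn : H' ≤ normalizer (H : Set G)) (h : IsSubnormalIn H' K) : IsSubnormalIn H K := by
  obtain ⟨n, c, h0, hl, hc⟩ := h
  refine ⟨n + 1, Fin.cons H c, rfl, ?_, ?_⟩
  · rw [← Fin.succ_last, Fin.cons_succ, hl]
  · intro i
    refine Fin.cases ?_ (fun j => ?_) i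
    · rw [Fin.castSucc_zero, Fin.cons_zero, Fin.cons_succ, h0]
      exact ⟨hle, (normal_subgroupOf_iff_le_normalizer hle).2 hn⟩
    · rw [← Fin.succ_castSucc, Fin.cons_succ, Fin.cons_succ]
      exact hc j

theorem IsSubnormalIn_refl {G : Type*} [Group G] (K : Subgroup G) : IsSubnormalIn K K :=
  ⟨0, fun _ => K, rfl, rfl, fun i => i.elim0⟩

theorem IsSubnormalIn_of_pGroup {G : Type*} [Group G] [Finite G] {p : ℕ} [Fact p.Prime]
    {R K : Subgroup G} (hR : IsPGroup p R) (hRK : R ≤ K) (hn : K ≤ normalizer (R : Set G))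
    (H : Subgroup G) (h : H ≤ R) : IsSubnormalIn H K := by
  induction H using WellFoundedGT.induction with
  | ind H ih =>
    rcases h.eq_or_lt with rfl | hlt
    · exact IsSubnormalIn_cons hRK hn (IsSubnormalIn_refl K)
    · exact IsSubnormalIn_cons (le_inf h le_normalizer) inf_le_right
        (ih _ (lt_inf_normalizer hR hlt) inf_le_left)

theorem subn_iff {G : Type*} [Group G] [Finite G] {p : ℕ} [Fact p.Prime]
    {x g : G} (hx : IsPGroup p (zpowers x)) :
    IsSubnormalIn (zpowers x) (zpowers x ⊔ zpowers g) ↔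
      ∃ R : Subgroup G, IsPGroup p R ∧ zpowers x ≤ R ∧ g ∈ normalizer (R : Set G) := by
  constructor
  · intro h
    obtain ⟨R, h1, h2, -, h4⟩ := exists_normal_pSubgroup hx h
    exact ⟨R, h1, h2, h4 (le_sup_right (a := zpowers x) (mem_zpowers g))⟩
  · rintro ⟨R, h1, h2, h3⟩
    have hK : zpowers x ⊔ zpowers g ≤ normalizer (R : Set G) :=
      sup_le (h2.trans le_normalizer) (zpowers_le.2 h3)
    refine IsSubnormalIn_of_pGroup (p := p) (R := R ⊓ (zpowers x ⊔ zpowers g))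
      h1.to_inf_left inf_le_right ?_ _ (le_inf h2 le_sup_left)
    rw [le_normalizer_iff]
    intro a ha b hb
    exact ⟨le_normalizer_iff.1 hK a ha b hb.1, Subgroup.mul_mem _ (Subgroup.mul_mem _ ha hb.2) (Subgroup.inv_mem _ ha)⟩

section main
variable {G : Type*} [Group G] [Finite G]

open scoped Classical in
noncomputable def subs (P : Subgroup G → Prop) : Finset (Subgroup G) :=
  (Set.toFinite {R : Subgroup G | P R}).toFinset

theorem mem_subs {P : Subgroup G → Prop} {R : Subgroup G} : R ∈ subs P ↔ P R := by
  simp [subs]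

noncomputable def els (M : Subgroup G) : Finset G := (Set.toFinite (M : Set G)).toFinset

theorem mem_els {M : Subgroup G} {g : G} : g ∈ els M ↔ g ∈ M := by
  simp [els]

theorem card_els (M : Subgroup G) : (els M).card = Nat.card M := by
  rw [els, ← Nat.card_eq_card_finite_toFinset]; rfl

/-- `g`-invariant `p`-subgroups of `M`. -/
noncomputable def PF (p : ℕ) (M : Subgroup G) (g : G) : Finset (Subgroup G) :=
  subs (fun R => R ≤ M ∧ IsPGroup p R ∧ g ∈ normalizer (R : Set G))

noncomputable def mm (p : ℕ) (M : Subgroup G) (g : G) : Subgroup G → ℤ :=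
  (exists_mob (PF p M g)).choose

open scoped Classical in
theorem mm_spec (p : ℕ) (M : Subgroup G) (g : G) :
    ∀ a ∈ PF p M g, ∑ b ∈ PF p M g with a ≤ b, mm p M g b = 1 :=
  (exists_mob (PF p M g)).choose_spec

noncomputable def hh (p : ℕ) (N M Q : Subgroup G) : ℤ :=
  ∑ g ∈ els (M ⊓ N ⊓ normalizer (Q : Set G)), mm p M g Q

theorem inf_mem_normalizer {g : G} {A B : Subgroup G} (hA : g ∈ normalizer (A : Set G))
    (hB : g ∈ normalizer (B : Set G)) : g ∈ normalizer ((A ⊓ B : Subgroup G) : Set G) := by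
  rw [mem_normalizer_iff] at *
  intro h
  rw [Subgroup.mem_inf, Subgroup.mem_inf, hA h, hB h]

theorem hh_local {p : ℕ} [Fact p.Prime] (N M Q : Subgroup G) (hQM : Q ≤ M) (hQ : IsPGroup p Q) :
    hh p N M Q = hh p N (M ⊓ normalizer (Q : Set G)) Q := by
  unfold hh
  have : M ⊓ N ⊓ normalizer (Q : Set G) =
    M ⊓ normalizer (Q : Set G) ⊓ N ⊓ normalizer (Q : Set G) := by
    ext; simp only [Subgroup.mem_inf]; tauto
  rw [← this]
  apply Finset.sum_congr rfl
  intro g hg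
  rw [mem_els] at hg
  refine mob_transfer (PF p M g) (PF p (M ⊓ normalizer (Q : Set G)) g) ?_
    (fun R => R ⊓ normalizer (Q : Set G)) ?_ ?_ _ _ (mm_spec _ _ _) (mm_spec _ _ _) Q ?_ ?_
  · intro R hR
    rw [PF, mem_subs] at *
    exact ⟨hR.1.trans inf_le_left, hR.2⟩
  · intro R hR
    rw [PF, mem_subs] at *
    exact ⟨inf_le_inf_right _ hR.1, hR.2.1.to_inf_left,
      inf_mem_normalizer hR.2.2 (le_normalizer hg.2)⟩
  · intro T hT R hR
    rw [PF, mem_subs] at *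
    rw [le_inf_iff]
    exact ⟨fun h => h.1, fun h => ⟨h, hT.1.trans inf_le_right⟩⟩
  · rw [PF, mem_subs]
    exact ⟨le_inf hQM le_normalizer, hQ, hg.2⟩
  · intro R hR
    rw [PF, mem_subs] at hR
    constructor
    · intro h
      by_contra hne
      have hlt : Q < R := lt_of_le_of_ne (h ▸ inf_le_left) (Ne.symm hne)
      exact (lt_inf_normalizer hR.2.1 hlt).ne h.symm
    · rintro rfl
      exact inf_eq_left.2 le_normalizer

open scoped Classical in
theorem sum_hh (p : ℕ) (N M H : Subgroup G) :
    ∑ R ∈ subs (fun R => R ≤ M ∧ IsPGroup p R ∧ H ≤ R), hh p N M R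
    = ∑ g ∈ els (M ⊓ N), ∑ R ∈ PF p M g with H ≤ R, mm p M g R := by
  unfold hh
  apply Finset.sum_comm'
  intro R g
  simp only [mem_subs, mem_els, PF, Finset.mem_filter, Subgroup.mem_inf]
  tauto

open scoped Classical in
theorem inner_sum (p : ℕ) (M H : Subgroup G) (g : G) :
    ∑ R ∈ PF p M g with H ≤ R, mm p M g R =
      if ∃ R ∈ PF p M g, H ≤ R then 1 else 0 := by
  split_ifs with h
  · obtain ⟨R0, hR0, hH0⟩ := h
    obtain ⟨Q, hQ⟩ := ((PF p M g).filter (fun R => H ≤ R)).exists_minimal ⟨R0, by simp [*]⟩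
    obtain ⟨hQ1, hmin⟩ := hQ
    rw [Finset.mem_filter] at hQ1
    rw [← mm_spec p M g Q hQ1.1]
    apply Finset.sum_congr _ (fun _ _ => rfl)
    ext R
    simp only [Finset.mem_filter, and_congr_right_iff]
    intro hR
    refine ⟨fun hHR => ?_, fun hQR => hQ1.2.trans hQR⟩
    have hi : Q ⊓ R ∈ (PF p M g).filter (fun R => H ≤ R) := by
      rw [Finset.mem_filter]
      refine ⟨?_, le_inf hQ1.2 hHR⟩
      have hQ2 := hQ1.1
      rw [PF, mem_subs] at *
      exact ⟨inf_le_left.trans hQ2.1, hQ2.2.1.to_inf_left, inf_mem_normalizer hQ2.2.2 hR.2.2⟩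
    exact (hmin hi inf_le_left).trans inf_le_right
  · rw [Finset.filter_eq_empty_iff.2 (fun R hR hHR => h ⟨R, hR, hHR⟩)]
    simp

/-- Sylow subgroups of `M`, as subgroups of `G`. -/
def IsSyl (p : ℕ) (M R : Subgroup G) : Prop := ∃ P : Sylow p M, (P : Subgroup M).map M.subtype = R

theorem IsSyl.le {p : ℕ} {M R : Subgroup G} (h : IsSyl p M R) : R ≤ M := by
  obtain ⟨P, rfl⟩ := h
  exact map_subtype_le _

theorem IsSyl.isP {p : ℕ} {M R : Subgroup G} (h : IsSyl p M R) : IsPGroup p R := by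
  obtain ⟨P, rfl⟩ := h
  exact P.2.map _

theorem exists_IsSyl {p : ℕ} {M R : Subgroup G} (hR : R ≤ M) (hp : IsPGroup p R) :
    ∃ S, IsSyl p M S ∧ R ≤ S := by
  obtain ⟨P, hP⟩ := (hp.comap_subtype (K := M)).exists_le_sylow
  refine ⟨_, ⟨P, rfl⟩, ?_⟩
  intro r hr
  exact ⟨⟨r, hR hr⟩, hP hr, rfl⟩

theorem IsSyl.max {p : ℕ} {M R S : Subgroup G} (h : IsSyl p M R) (hS : S ≤ M)
    (hp : IsPGroup p S) (hRS : R ≤ S) : S = R := by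
  obtain ⟨P, rfl⟩ := h
  have := P.3 (hp.comap_subtype (K := M)) (fun y hy => hRS ⟨y, hy, rfl⟩)
  apply le_antisymm _ hRS
  intro s hs
  refine ⟨⟨s, hS hs⟩, ?_, rfl⟩
  rw [← this]
  exact hs

theorem IsSyl.normal_le {p : ℕ} {M R Q : Subgroup G} (h : IsSyl p M R) (hQ : Q ≤ M)
    (hp : IsPGroup p Q) (hn : M ≤ normalizer (Q : Set G)) : Q ≤ R := by
  have h1 : IsPGroup p (R ⊔ Q : Subgroup G) :=
    h.isP.to_sup_of_normal_right' hp (h.le.trans hn)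
  have := h.max (sup_le h.le hQ) h1 le_sup_left
  rw [← this]; exact le_sup_right

theorem sum_IsSyl {p : ℕ} [Fact p.Prime] (N M : Subgroup G) [N.Normal] {k : ℕ}
    (hN : N.index ∣ p ^ k) :
    ∑ R ∈ subs (IsSyl p M), Nat.card (M ⊓ N ⊓ normalizer (R : Set G) : Subgroup G)
     = Nat.card (M ⊓ N : Subgroup G) := by
  classical
  have : Fintype (Sylow p M) := Fintype.ofFinite _
  have hL : (N.subgroupOf M).index ∣ p ^ k :=
    (relIndex_dvd_index_of_normal N M).trans hN
  have key := sum_sylow (p := p) (N.subgroupOf M) hL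
  have himg : subs (IsSyl p M) = Finset.univ.image
      (fun P : Sylow p M => (P : Subgroup M).map M.subtype) := by
    ext R; simp [mem_subs, IsSyl]
  rw [himg, Finset.sum_image]
  · have e2 : Nat.card (M ⊓ N : Subgroup G) = Nat.card (N.subgroupOf M) := by
      rw [← Subgroup.card_map_of_injective M.subtype_injective (K := N.subgroupOf M),
        subgroupOf_map_subtype, inf_comm]
    rw [e2, ← key]
    apply Finset.sum_congr rfl
    intro P _
    rw [← Subgroup.card_map_of_injective M.subtype_injective
      (K := N.subgroupOf M ⊓ normalizer ((P : Subgroup M) : Set M))]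
    have e3 : normalizer ((P : Subgroup M) : Set M) =
        (normalizer (((P : Subgroup M).map M.subtype : Subgroup G) : Set G)).subgroupOf M := by
      rw [subgroupOf_normalizer_eq (map_subtype_le _)]
      congr 2
      exact (comap_map_eq_self_of_injective M.subtype_injective _).symm
    rw [e3]
    congr! 3 with y
    simp only [Subgroup.mem_map, Subgroup.mem_inf, mem_subgroupOf]
    constructor
    · rintro ⟨⟨h1, h2⟩, h3⟩
      exact ⟨⟨y, h1⟩, ⟨h2, h3⟩, rfl⟩
    · rintro ⟨⟨y, h1⟩, ⟨h2, h3⟩, rfl⟩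
      exact ⟨⟨h1, h2⟩, h3⟩
  · intro P _ P' _ h
    exact Sylow.ext (map_injective M.subtype_injective h)

open scoped Classical in
theorem hh_syl {p : ℕ} {N M Q : Subgroup G} (h : IsSyl p M Q) :
    hh p N M Q = Nat.card (M ⊓ N ⊓ normalizer (Q : Set G) : Subgroup G) := by
  rw [hh, ← card_els, Finset.card_eq_sum_ones, Nat.cast_sum]
  apply Finset.sum_congr rfl
  intro g hg
  rw [mem_els] at hg
  have hmem : Q ∈ PF p M g := by
    rw [PF, mem_subs]; exact ⟨h.le, h.isP, hg.2⟩
  have := mm_spec p M g Q hmem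
  have he : (PF p M g).filter (fun b => Q ≤ b) = {Q} := by
    ext R
    simp only [Finset.mem_filter, Finset.mem_singleton]
    constructor
    · rintro ⟨h1, h2⟩
      rw [PF, mem_subs] at h1
      exact h.max h1.1 h1.2.1 h2
    · rintro rfl; exact ⟨hmem, le_rfl⟩
  rw [he] at this
  simpa using this

theorem hh_not_syl {p : ℕ} [Fact p.Prime] (N : Subgroup G) [N.Normal] {k : ℕ}
    (hN : N.index ∣ p ^ k) (M : Subgroup G) :
    ∀ Q : Subgroup G, Q ≤ M → IsPGroup p Q → ¬ IsSyl p M Q → hh p N M Q = 0 := by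
  classical
  induction M using WellFoundedLT.induction with
  | ind M ihM =>
  intro Q
  induction Q using WellFoundedGT.induction with
  | ind Q ihQ =>
  intro hQM hQ hns
  by_cases hn : M ≤ normalizer (Q : Set G)
  · have h1 := sum_hh p N M Q
    have h2 : ∑ g ∈ els (M ⊓ N), ∑ R ∈ PF p M g with Q ≤ R, mm p M g R =
        (Nat.card (M ⊓ N : Subgroup G) : ℤ) := by
      rw [← card_els, Finset.card_eq_sum_ones, Nat.cast_sum]
      apply Finset.sum_congr rfl
      intro g hg
      rw [mem_els] at hg
      rw [inner_sum, if_pos]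
      · simp
      · refine ⟨Q, ?_, le_rfl⟩
        rw [PF, mem_subs]
        exact ⟨hQM, hQ, hn hg.1⟩
    rw [h2, ← sum_IsSyl (p := p) N M hN, Nat.cast_sum] at h1
    have hQm : Q ∈ subs (fun R => R ≤ M ∧ IsPGroup p R ∧ Q ≤ R) := by
      rw [mem_subs]; exact ⟨hQM, hQ, le_rfl⟩
    rw [← Finset.add_sum_erase _ _ hQm] at h1
    have h3 : ∑ R ∈ (subs (fun R => R ≤ M ∧ IsPGroup p R ∧ Q ≤ R)).erase Q, hh p N M R =
        ∑ R ∈ subs (IsSyl p M),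
          (Nat.card (M ⊓ N ⊓ normalizer (R : Set G) : Subgroup G) : ℤ) := by
      rw [← Finset.sum_congr rfl (fun R hR => hh_syl (N := N) (mem_subs.1 hR))]
      symm
      apply Finset.sum_subset
      · intro R hR
        rw [mem_subs] at hR
        rw [Finset.mem_erase, mem_subs]
        refine ⟨?_, hR.le, hR.isP, hR.normal_le hQM hQ hn⟩
        rintro rfl
        exact hns hR
      · intro R hR hR'
        rw [Finset.mem_erase, mem_subs] at hR
        rw [mem_subs] at hR'
        exact ihQ R (lt_of_le_of_ne hR.2.2.2 (Ne.symm hR.1)) hR.2.1 hR.2.2.1 hR'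
    rw [h3] at h1
    linarith
  · rw [hh_local N M Q hQM hQ]
    refine ihM _ (lt_of_le_of_ne inf_le_left (fun h => hn (inf_eq_left.1 h))) Q
      (le_inf hQM le_normalizer) hQ ?_
    intro hs
    obtain ⟨S, hS, hQS⟩ := exists_IsSyl hQM hQ
    have hlt : Q < S := lt_of_le_of_ne hQS (fun h => hns (h ▸ hS))
    have := lt_inf_normalizer hS.isP hlt
    exact this.ne (hs.max (inf_le_inf_right _ hS.le) hS.isP.to_inf_left this.le).symm

theorem card_eq {p : ℕ} [Fact p.Prime] (N : Subgroup G) [N.Normal] {k : ℕ}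
    (hN : N.index ∣ p ^ k) (x : G) (hx : IsPGroup p (zpowers x)) :
    Nat.card (subnormalizerSetIn N x) =
      ∑ R ∈ subs (fun R => IsSyl p ⊤ R ∧ zpowers x ≤ R),
        Nat.card (N ⊓ normalizer (R : Set G) : Subgroup G) := by
  classical
  have h1 := sum_hh p N ⊤ (zpowers x)
  have h2 : ∑ g ∈ els (⊤ ⊓ N), ∑ R ∈ PF p ⊤ g with zpowers x ≤ R, mm p ⊤ g R =
      (Nat.card (subnormalizerSetIn N x) : ℤ) := by
    rw [Finset.sum_congr rfl (fun g _ => inner_sum p ⊤ (zpowers x) g), Finset.sum_boole,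
      Nat.cast_inj, Nat.card_coe_set_eq, ← Set.ncard_coe_finset]
    congr 1
    ext g
    simp only [Finset.coe_filter, Set.mem_ofPred_eq, subnormalizerSetIn, subn_iff hx, mem_els, PF,
      mem_subs, top_inf_eq, le_top, true_and]
    refine and_congr_right fun _ => exists_congr fun R => ?_
    tauto
  have h3 : ∑ R ∈ subs (fun R => R ≤ ⊤ ∧ IsPGroup p R ∧ zpowers x ≤ R), hh p N ⊤ R =
      ∑ R ∈ subs (fun R => IsSyl p ⊤ R ∧ zpowers x ≤ R),
        (Nat.card (N ⊓ normalizer (R : Set G) : Subgroup G) : ℤ) := by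
    have : ∀ R ∈ subs (fun R : Subgroup G => IsSyl p ⊤ R ∧ zpowers x ≤ R),
        (Nat.card (N ⊓ normalizer (R : Set G) : Subgroup G) : ℤ) = hh p N ⊤ R := by
      intro R hR
      rw [hh_syl (mem_subs.1 hR).1, top_inf_eq]
    rw [Finset.sum_congr rfl this]
    symm
    apply Finset.sum_subset
    · intro R hR
      rw [mem_subs] at *
      exact ⟨le_top, hR.1.isP, hR.2⟩
    · intro R hR hR'
      rw [mem_subs] at *
      exact hh_not_syl N hN ⊤ R le_top hR.2.1 (fun h => hR' ⟨h, hR.2.2⟩)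
  rw [h2, h3] at h1
  exact_mod_cast h1.symm

end main
end SubnAux

theorem card_subnormalizer_of_eq_sup {G : Type*} [Group G] [Fintype G]
    (p : ℕ) (hp : p.Prime) (N : Subgroup G) (hN : N.Normal)
    (P : Sylow p G) (x : G) (hx : x ∈ P)
    (hG : N ⊔ (P : Subgroup G) = ⊤) :
    Nat.card (subnormalizerSet x) = Nat.card (subnormalizerSetIn N x) * N.index := by
  have : Fact p.Prime := ⟨hp⟩
  have hxp : IsPGroup p (zpowers x) := P.2.to_le (zpowers_le.2 hx)
  obtain ⟨k, hk⟩ := IsPGroup.iff_card.1 P.2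
  have hidx : N.index ∣ p ^ k := by
    rw [← hk, ← relIndex_top_right, ← hG, relIndex_sup_left]
    exact relIndex_dvd_card _ _
  have e1 : subnormalizerSet x = subnormalizerSetIn ⊤ x := by
    ext g; simp [subnormalizerSet, subnormalizerSetIn]
  rw [e1, SubnAux.card_eq (p := p) (k := 0) ⊤ (by simp) x hxp, SubnAux.card_eq N hidx x hxp,
    Finset.sum_mul]
  apply Finset.sum_congr rfl
  intro R hR
  rw [SubnAux.mem_subs] at hR
  rw [top_inf_eq]
  have hsup : N ⊔ normalizer (R : Set G) = ⊤ := by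
    obtain ⟨S, hS⟩ := hR.1.isP.exists_le_sylow
    have hSR := hR.1.max le_top S.2 hS
    have h := SubnAux.sup_eq_top_of_sylow N hidx S
    rw [hSR] at h
    exact top_le_iff.1 (h.ge.trans (sup_le_sup_left le_normalizer _))
  have e2 : N.index = N.relIndex (normalizer (R : Set G)) := by
    rw [← relIndex_top_right, ← hsup, relIndex_sup_left]
  rw [e2, ← inf_relIndex_right, relIndex,
    ← card_mul_index ((N ⊓ normalizer (R : Set G)).subgroupOf (normalizer (R : Set G)))]
  congr 1
  rw [← Subgroup.card_map_of_injective (subtype_injective _)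
    (K := (N ⊓ normalizer (R : Set G)).subgroupOf (normalizer (R : Set G))),
    subgroupOf_map_subtype, inf_eq_left.2 inf_le_right]
end
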